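/- arXiv:1211.6045 — 11 statements merged into one kernel-verified Lean document; each statement's English description precedes it below -/
import Mathlib

section
/- Let l1, l2, l3, m1, m2 be positive reals, l2 ≠ l3, c a real number, and set m3 = m2*l2/l3. Then at every point of the set M = {(γ1, γ2, π1, π2) : γ2 = −2γ1, π1 = c, π2 = −c*l3/(l2−l3)} the partial derivatives of the reduced Hamiltonian H satisfy ∂H/∂γ1 = 0, ∂H/∂γ2 = 0, ∂H/∂π1 = c/(l2*m2*(l2−l3)) and ∂H/∂π2 = −2c/(l2*m2*(l2−l3)). Consequently M is invariant under the Hamiltonian flow of H, and on M the flow is γ1(t) = γ1(0) + c*t/(l2*m2*(l2−l3)). -/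
/-- The reduced flail-pendulum Hamiltonian in the variables `(γ1, γ2, p1, p2)`,
where `p1, p2` are the momenta conjugate to the angles `γ1, γ2`. -/
noncomputable def flailH (l1 l2 l3 m1 m2 m3 c : ℝ) (γ1 γ2 p1 p2 : ℝ) : ℝ :=
  (l1 ^ 2 * (m1 + m2 + m3) * (l3 ^ 2 * m3 * (p1 - p2) ^ 2 + l2 ^ 2 * m2 * p2 ^ 2)
      + l2 ^ 2 * l3 ^ 2 * m2 * m3 * (p1 - c) ^ 2
      - l1 * (l1 * l2 ^ 2 * m2 ^ 2 * p2 ^ 2 * Real.cos γ1 ^ 2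
          + l3 * m3 * Real.cos (γ1 + γ2) *
              (2 * l2 ^ 2 * m2 * p2 * (c - p1)
                + l1 * l3 * m3 * (p1 - p2) ^ 2 * Real.cos (γ1 + γ2))
          - 2 * l2 * l3 * m2 * m3 * (p1 - p2) * Real.cos γ1 *
              (l3 * (p1 - c) + l1 * p2 * Real.cos (γ1 + γ2)))) /
    (2 * l1 ^ 2 * l2 ^ 2 * l3 ^ 2 * m2 * m3 *
      ((m1 + m2 + m3) - m2 * Real.cos γ1 ^ 2 - m3 * Real.cos (γ1 + γ2) ^ 2))

lemma flail_B_pos (m1 m2 m3 x y : ℝ) (hm1 : 0 < m1) (hm2 : 0 < m2) (hm3 : 0 < m3) :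
    0 < (m1 + m2 + m3) - m2 * Real.cos x ^ 2 - m3 * Real.cos y ^ 2 := by
  have h1 := mul_le_mul_of_nonneg_left (Real.cos_sq_le_one x) hm2.le
  have h2 := mul_le_mul_of_nonneg_left (Real.cos_sq_le_one y) hm3.le
  linarith

/-- On the momentum level of `M`, the Hamiltonian simplifies. -/
lemma flail_on_level (l1 l2 l3 m1 m2 m3 k x y : ℝ)
    (hl1 : 0 < l1) (hl2 : 0 < l2) (hl3 : 0 < l3)
    (hm1 : 0 < m1) (hm2 : 0 < m2) (hm3 : 0 < m3) :
    flailH l1 l2 l3 m1 m2 m3 (k * (l2 - l3)) x y (k * (l2 - l3)) (-k * l3) =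
      k ^ 2 / (2 * m2 * m3) * (((m1 + m2 + m3) * (m2 + m3)
        - (m2 * Real.cos x + m3 * Real.cos (x + y)) ^ 2) /
      ((m1 + m2 + m3) - m2 * Real.cos x ^ 2 - m3 * Real.cos (x + y) ^ 2)) := by
  have hB := (flail_B_pos m1 m2 m3 x (x + y) hm1 hm2 hm3).ne'
  unfold flailH
  generalize Real.cos x = C1 at *
  generalize Real.cos (x + y) = C2 at *
  generalize hBe : (m1 + m2 + m3) - m2 * C1 ^ 2 - m3 * C2 ^ 2 = B at *
  field_simp
  ring

/-- Critical behaviour of the simplified Hamiltonian along curves of angles. -/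
lemma flail_angle_deriv (m1 m2 m3 a s0 : ℝ) (u v : ℝ → ℝ) (u' v' : ℝ)
    (hm1 : 0 < m1) (hm2 : 0 < m2) (hm3 : 0 < m3)
    (hu : HasDerivAt u u' s0) (hv : HasDerivAt v v' s0)
    (huv : Real.cos (v s0) = Real.cos (u s0)) :
    HasDerivAt (fun s => a * (((m1 + m2 + m3) * (m2 + m3)
        - (m2 * Real.cos (u s) + m3 * Real.cos (v s)) ^ 2) /
      ((m1 + m2 + m3) - m2 * Real.cos (u s) ^ 2 - m3 * Real.cos (v s) ^ 2))) 0 s0 := by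
  have hB := (flail_B_pos m1 m2 m3 (u s0) (v s0) hm1 hm2 hm3).ne'
  have hcu := hu.cos
  have hcv := hv.cos
  have hN := (((hcu.const_mul m2).add (hcv.const_mul m3)).pow 2).const_sub
    ((m1 + m2 + m3) * (m2 + m3))
  have hD := ((((hcu.pow 2).const_mul m2).const_sub (m1 + m2 + m3))).sub
    ((hcv.pow 2).const_mul m3)
  have h := (hN.div hD hB).const_mul a
  refine h.congr_deriv ?_
  simp only [Pi.add_apply, Pi.sub_apply, Pi.pow_apply]
  rw [huv]
  rw [mul_eq_zero, div_eq_zero_iff]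
  right; left
  push_cast
  ring

lemma flail_p1_deriv (l1 l2 l3 m1 m2 m3 k x y : ℝ)
    (hl1 : 0 < l1) (hl2 : 0 < l2) (hl3 : 0 < l3)
    (hm1 : 0 < m1) (hm2 : 0 < m2) (hm3 : 0 < m3) (hm : m2 * l2 = m3 * l3)
    (hxy : Real.cos (x + y) = Real.cos x) :
    HasDerivAt (fun s => flailH l1 l2 l3 m1 m2 m3 (k * (l2 - l3)) x y s (-k * l3))
      (k / (l2 * m2)) (k * (l2 - l3)) := by
  have hB := (flail_B_pos m1 m2 m3 x x hm1 hm2 hm3).ne'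
  unfold flailH
  rw [hxy]
  generalize Real.cos x = C at *
  have hs := hasDerivAt_id' (k * (l2 - l3))
  have h1 := hs.sub_const (-k * l3)
  have h2 := hs.sub_const (k * (l2 - l3))
  have h3 := hs.const_sub (k * (l2 - l3))
  have e1 := ((((h1.pow 2).const_mul (l3 ^ 2 * m3)).add_const
    (l2 ^ 2 * m2 * (-k * l3) ^ 2)).const_mul (l1 ^ 2 * (m1 + m2 + m3))).add
    ((h2.pow 2).const_mul (l2 ^ 2 * l3 ^ 2 * m2 * m3))
  have e2 := ((h3.const_mul (2 * l2 ^ 2 * m2 * (-k * l3))).add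
    (((h1.pow 2).const_mul (l1 * l3 * m3)).mul_const C)).const_mul (l3 * m3 * C)
  have e3 := ((h1.const_mul (2 * l2 * l3 * m2 * m3)).mul_const C).mul
    ((h2.const_mul l3).add_const (l1 * (-k * l3) * C))
  have e := (e1.sub (((e2.const_add (l1 * l2 ^ 2 * m2 ^ 2 * (-k * l3) ^ 2 * C ^ 2)).sub
    e3).const_mul l1)).div_const (2 * l1 ^ 2 * l2 ^ 2 * l3 ^ 2 * m2 * m3 *
      ((m1 + m2 + m3) - m2 * C ^ 2 - m3 * C ^ 2))
  refine e.congr_deriv ?_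
  have hm' : m2 = m3 * l3 / l2 := by field_simp; linarith
  rw [div_eq_div_iff (by positivity) (by positivity)]
  push_cast
  subst hm'
  field_simp
  ring

lemma flail_p2_deriv (l1 l2 l3 m1 m2 m3 k x y : ℝ)
    (hl1 : 0 < l1) (hl2 : 0 < l2) (hl3 : 0 < l3)
    (hm1 : 0 < m1) (hm2 : 0 < m2) (hm3 : 0 < m3) (hm : m2 * l2 = m3 * l3)
    (hxy : Real.cos (x + y) = Real.cos x) :
    HasDerivAt (fun s => flailH l1 l2 l3 m1 m2 m3 (k * (l2 - l3)) x y (k * (l2 - l3)) s)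
      (-2 * k / (l2 * m2)) (-k * l3) := by
  have hB := (flail_B_pos m1 m2 m3 x x hm1 hm2 hm3).ne'
  have hB0 : 2 * l1 ^ 2 * l2 ^ 2 * l3 ^ 2 * m2 * m3 *
      ((m1 + m2 + m3) - m2 * Real.cos x ^ 2 - m3 * Real.cos x ^ 2) ≠ 0 := by
    have := hl1.ne'
    positivity
  unfold flailH
  rw [hxy]
  generalize Real.cos x = C at *
  have hs := hasDerivAt_id' (-k * l3)
  have h1 := hs.const_sub (k * (l2 - l3))
  have e1 := ((((h1.pow 2).const_mul (l3 ^ 2 * m3)).add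
    ((hs.pow 2).const_mul (l2 ^ 2 * m2))).const_mul (l1 ^ 2 * (m1 + m2 + m3))).add_const
    (l2 ^ 2 * l3 ^ 2 * m2 * m3 * (k * (l2 - l3) - k * (l2 - l3)) ^ 2)
  have e0 := ((hs.pow 2).const_mul (l1 * l2 ^ 2 * m2 ^ 2)).mul_const (C ^ 2)
  have e2 := (((hs.const_mul (2 * l2 ^ 2 * m2)).mul_const (k * (l2 - l3) - k * (l2 - l3))).add
    (((h1.pow 2).const_mul (l1 * l3 * m3)).mul_const C)).const_mul (l3 * m3 * C)
  have e3 := ((h1.const_mul (2 * l2 * l3 * m2 * m3)).mul_const C).mul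
    (((hs.const_mul l1).mul_const C).const_add (l3 * (k * (l2 - l3) - k * (l2 - l3))))
  have e := (e1.sub (((e0.add e2).sub e3).const_mul l1)).div_const
    (2 * l1 ^ 2 * l2 ^ 2 * l3 ^ 2 * m2 * m3 *
      ((m1 + m2 + m3) - m2 * C ^ 2 - m3 * C ^ 2))
  refine e.congr_deriv ?_
  have hm' : m2 = m3 * l3 / l2 := by field_simp; linarith
  rw [div_eq_div_iff hB0 (by positivity)]
  push_cast
  subst hm'
  field_simp
  ring

/-- On the set `M = {γ2 = -2γ1, p1 = c, p2 = -c l3/(l2 - l3)}` the partial derivatives of the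
reduced Hamiltonian (with `m3 = m2 l2 / l3`) take the indicated values; consequently `M` is
invariant under the Hamiltonian flow and on `M` the flow is
`γ1 t = γ1 0 + c t/(l2 m2 (l2 - l3))`. -/
theorem stmt_0 (l1 l2 l3 m1 m2 c : ℝ)
    (hl1 : 0 < l1) (hl2 : 0 < l2) (hl3 : 0 < l3)
    (hm1 : 0 < m1) (hm2 : 0 < m2) (hne : l2 ≠ l3)
    (H : ℝ → ℝ → ℝ → ℝ → ℝ) (hH : H = flailH l1 l2 l3 m1 m2 (m2 * l2 / l3) c) :
    (∀ γ1 : ℝ,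
      deriv (fun s => H s (-2 * γ1) c (-c * l3 / (l2 - l3))) γ1 = 0 ∧
      deriv (fun s => H γ1 s c (-c * l3 / (l2 - l3))) (-2 * γ1) = 0 ∧
      deriv (fun s => H γ1 (-2 * γ1) s (-c * l3 / (l2 - l3))) c
        = c / (l2 * m2 * (l2 - l3)) ∧
      deriv (fun s => H γ1 (-2 * γ1) c s) (-c * l3 / (l2 - l3))
        = -2 * c / (l2 * m2 * (l2 - l3)))
    ∧
    -- the curve `t ↦ (γ1 t, -2 γ1 t, c, -c l3/(l2-l3))` with
    -- `γ1 t = γ1 0 + c t/(l2 m2 (l2 - l3))` solves Hamilton's equations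
    (∀ γ10 t : ℝ,
      HasDerivAt (fun τ => γ10 + c * τ / (l2 * m2 * (l2 - l3)))
        (deriv (fun s => H (γ10 + c * t / (l2 * m2 * (l2 - l3)))
            (-2 * (γ10 + c * t / (l2 * m2 * (l2 - l3)))) s
            (-c * l3 / (l2 - l3))) c) t ∧
      HasDerivAt (fun τ => -2 * (γ10 + c * τ / (l2 * m2 * (l2 - l3))))
        (deriv (fun s => H (γ10 + c * t / (l2 * m2 * (l2 - l3)))
            (-2 * (γ10 + c * t / (l2 * m2 * (l2 - l3)))) c s)
          (-c * l3 / (l2 - l3))) t ∧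
      HasDerivAt (fun _ : ℝ => c)
        (-(deriv (fun s => H s
            (-2 * (γ10 + c * t / (l2 * m2 * (l2 - l3)))) c
            (-c * l3 / (l2 - l3))) (γ10 + c * t / (l2 * m2 * (l2 - l3))))) t ∧
      HasDerivAt (fun _ : ℝ => -c * l3 / (l2 - l3))
        (-(deriv (fun s => H (γ10 + c * t / (l2 * m2 * (l2 - l3))) s c
            (-c * l3 / (l2 - l3)))
          (-2 * (γ10 + c * t / (l2 * m2 * (l2 - l3)))))) t) := by
  have hsub : l2 - l3 ≠ 0 := sub_ne_zero.mpr hne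
  have hm3 : 0 < m2 * l2 / l3 := by positivity
  have hm : m2 * l2 = m2 * l2 / l3 * l3 := by field_simp
  obtain ⟨k, rfl⟩ : ∃ k, c = k * (l2 - l3) := ⟨c / (l2 - l3), by field_simp⟩
  have hp : -(k * (l2 - l3)) * l3 / (l2 - l3) = -k * l3 := by field_simp
  have hcos : ∀ x : ℝ, Real.cos (x + -2 * x) = Real.cos x := by
    intro x
    rw [show x + -2 * x = -x by ring, Real.cos_neg]
  have hk1 : k * (l2 - l3) / (l2 * m2 * (l2 - l3)) = k / (l2 * m2) := by field_simp
  have hk2 : -2 * (k * (l2 - l3)) / (l2 * m2 * (l2 - l3)) = -2 * k / (l2 * m2) := by field_simp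
  have main : ∀ γ1 : ℝ,
      deriv (fun s => H s (-2 * γ1) (k * (l2 - l3))
        (-(k * (l2 - l3)) * l3 / (l2 - l3))) γ1 = 0 ∧
      deriv (fun s => H γ1 s (k * (l2 - l3))
        (-(k * (l2 - l3)) * l3 / (l2 - l3))) (-2 * γ1) = 0 ∧
      deriv (fun s => H γ1 (-2 * γ1) s (-(k * (l2 - l3)) * l3 / (l2 - l3))) (k * (l2 - l3))
        = k * (l2 - l3) / (l2 * m2 * (l2 - l3)) ∧
      deriv (fun s => H γ1 (-2 * γ1) (k * (l2 - l3)) s) (-(k * (l2 - l3)) * l3 / (l2 - l3))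
        = -2 * (k * (l2 - l3)) / (l2 * m2 * (l2 - l3)) := by
    intro x
    rw [hp, hk1, hk2, hH]
    refine ⟨?_, ?_, ?_, ?_⟩
    · simp only [flail_on_level l1 l2 l3 m1 m2 _ k _ _ hl1 hl2 hl3 hm1 hm2 hm3]
      exact (flail_angle_deriv m1 m2 _ _ x (fun s => s) (fun s => s + -2 * x) 1 1 hm1 hm2 hm3
        (hasDerivAt_id' x) ((hasDerivAt_id' x).add_const _) (hcos x)).deriv
    · simp only [flail_on_level l1 l2 l3 m1 m2 _ k _ _ hl1 hl2 hl3 hm1 hm2 hm3]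
      exact (flail_angle_deriv m1 m2 _ _ (-2 * x) (fun _ => x) (fun s => x + s) 0 1 hm1 hm2 hm3
        (hasDerivAt_const _ x) ((hasDerivAt_id' _).const_add _) (hcos x)).deriv
    · exact (flail_p1_deriv l1 l2 l3 m1 m2 _ k x _ hl1 hl2 hl3 hm1 hm2 hm3 hm (hcos x)).deriv
    · exact (flail_p2_deriv l1 l2 l3 m1 m2 _ k x _ hl1 hl2 hl3 hm1 hm2 hm3 hm (hcos x)).deriv
  refine ⟨main, fun γ10 t => ?_⟩
  obtain ⟨d1, d2, d3, d4⟩ := main (γ10 + k * (l2 - l3) * t / (l2 * m2 * (l2 - l3)))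
  rw [d1, d2, d3, d4]
  have hγ : HasDerivAt (fun τ => γ10 + k * (l2 - l3) * τ / (l2 * m2 * (l2 - l3)))
      (k * (l2 - l3) / (l2 * m2 * (l2 - l3))) t := by
    refine ((((hasDerivAt_id' t).const_mul (k * (l2 - l3))).div_const
      (l2 * m2 * (l2 - l3))).const_add γ10).congr_deriv ?_
    rw [mul_one]
  refine ⟨hγ, (hγ.const_mul (-2)).congr_deriv (by ring), ?_, ?_⟩
  · rw [neg_zero]; exact hasDerivAt_const _ _
  · rw [neg_zero]; exact hasDerivAt_const _ _
end

section
/- Let l1, l2, l3, m1, m2 be positive reals, l2 ≠ l3, and c real. For every real x2 with D(x2) := −2l3m1 − (l2+l3)m2 + (l2+l3)m2*cos(2x2) ≠ 0, the variational matrix entries satisfy the three identities −l3*a31(x2) + (l2+l3)*a41(x2) = 0, −l3*a33(x2) + (l2+l3)*a43(x2) = 0, and −l3*a34(x2) + (l2+l3)*a44(x2) = 0. Consequently, along any solution (X1(t), Y1(t), Y2(t)) of the linear system Ẏ1 = a31X1 + a33Y1 + a34Y2, Ẏ2 = a41X1 + a43Y1 + a44Y2 (with x2 = x2(t) any function avoiding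 zeros of D), the quantity −l3*Y1 + (l2+l3)*Y2 is constant in t. -/
/-- The common denominator factor `D(x2) = -2 l3 m1 - (l2+l3) m2 + (l2+l3) m2 cos(2 x2)`. -/
noncomputable def Dden (l2 l3 m1 m2 x2 : ℝ) : ℝ :=
  -2 * l3 * m1 - (l2 + l3) * m2 + (l2 + l3) * m2 * Real.cos (2 * x2)

/-- Variational matrix entry `a31`. -/
noncomputable def a31 (l1 l2 l3 m1 m2 c x2 : ℝ) : ℝ :=
  2 * c ^ 2 * (l2 + l3) * Real.sin x2 ^ 2 / ((l2 - l3) ^ 2 * Dden l2 l3 m1 m2 x2)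

/-- Variational matrix entry `a33`. -/
noncomputable def a33 (l1 l2 l3 m1 m2 c x2 : ℝ) : ℝ :=
  -2 * c * (l2 + l3) * (l2 + l1 * Real.cos x2) * Real.sin x2 /
    (l1 * l2 * (l2 - l3) * Dden l2 l3 m1 m2 x2)

/-- Variational matrix entry `a34`. -/
noncomputable def a34 (l1 l2 l3 m1 m2 c x2 : ℝ) : ℝ :=
  2 * c * (l2 + l3) * Real.sin x2 / (l1 * l3 * Dden l2 l3 m1 m2 x2)

/-- Variational matrix entry `a41`. -/
noncomputable def a41 (l1 l2 l3 m1 m2 c x2 : ℝ) : ℝ :=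
  2 * c ^ 2 * l3 * Real.sin x2 ^ 2 / ((l2 - l3) ^ 2 * Dden l2 l3 m1 m2 x2)

/-- Variational matrix entry `a43`. -/
noncomputable def a43 (l1 l2 l3 m1 m2 c x2 : ℝ) : ℝ :=
  -2 * c * l3 * (l2 + l1 * Real.cos x2) * Real.sin x2 /
    (l1 * l2 * (l2 - l3) * Dden l2 l3 m1 m2 x2)

/-- Variational matrix entry `a44`. -/
noncomputable def a44 (l1 l2 l3 m1 m2 c x2 : ℝ) : ℝ :=
  2 * c * Real.sin x2 / (l1 * Dden l2 l3 m1 m2 x2)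

/-- The three linear identities among the variational matrix entries, and the resulting
first integral `-l3 Y1 + (l2+l3) Y2` of the variational subsystem for `(Y1, Y2)`. -/
theorem stmt_2 (l1 l2 l3 m1 m2 c : ℝ)
    (hl1 : 0 < l1) (hl2 : 0 < l2) (hl3 : 0 < l3)
    (hm1 : 0 < m1) (hm2 : 0 < m2) (hne : l2 ≠ l3) :
    (∀ x2 : ℝ, Dden l2 l3 m1 m2 x2 ≠ 0 →
      (-l3 * a31 l1 l2 l3 m1 m2 c x2 + (l2 + l3) * a41 l1 l2 l3 m1 m2 c x2 = 0 ∧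
       -l3 * a33 l1 l2 l3 m1 m2 c x2 + (l2 + l3) * a43 l1 l2 l3 m1 m2 c x2 = 0 ∧
       -l3 * a34 l1 l2 l3 m1 m2 c x2 + (l2 + l3) * a44 l1 l2 l3 m1 m2 c x2 = 0))
    ∧
    (∀ (I : Set ℝ), Convex ℝ I → ∀ x2 X1 Y1 Y2 : ℝ → ℝ,
      (∀ t ∈ I, Dden l2 l3 m1 m2 (x2 t) ≠ 0) →
      (∀ t ∈ I, HasDerivAt Y1
        (a31 l1 l2 l3 m1 m2 c (x2 t) * X1 t + a33 l1 l2 l3 m1 m2 c (x2 t) * Y1 t +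
          a34 l1 l2 l3 m1 m2 c (x2 t) * Y2 t) t) →
      (∀ t ∈ I, HasDerivAt Y2
        (a41 l1 l2 l3 m1 m2 c (x2 t) * X1 t + a43 l1 l2 l3 m1 m2 c (x2 t) * Y1 t +
          a44 l1 l2 l3 m1 m2 c (x2 t) * Y2 t) t) →
      ∀ t ∈ I, ∀ s ∈ I,
        -l3 * Y1 t + (l2 + l3) * Y2 t = -l3 * Y1 s + (l2 + l3) * Y2 s) := by
  have key : ∀ x2 : ℝ, Dden l2 l3 m1 m2 x2 ≠ 0 →
      (-l3 * a31 l1 l2 l3 m1 m2 c x2 + (l2 + l3) * a41 l1 l2 l3 m1 m2 c x2 = 0 ∧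
       -l3 * a33 l1 l2 l3 m1 m2 c x2 + (l2 + l3) * a43 l1 l2 l3 m1 m2 c x2 = 0 ∧
       -l3 * a34 l1 l2 l3 m1 m2 c x2 + (l2 + l3) * a44 l1 l2 l3 m1 m2 c x2 = 0) := by
    intro x2 hD
    unfold a31 a41 a33 a43 a34 a44
    refine ⟨by ring, by ring, ?_⟩
    field_simp
    ring
  refine ⟨key, ?_⟩
  intro I hI x2 X1 Y1 Y2 hD h1 h2 t ht s hs
  have hder : ∀ u ∈ I, HasDerivWithinAt (fun u => -l3 * Y1 u + (l2 + l3) * Y2 u) 0 I u := by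
    intro u hu
    obtain ⟨k1, k2, k3⟩ := key (x2 u) (hD u hu)
    have h := ((h1 u hu).const_mul (-l3)).add ((h2 u hu).const_mul (l2 + l3))
    refine HasDerivAt.hasDerivWithinAt (HasDerivAt.congr_deriv h ?_)
    linear_combination X1 u * k1 + Y1 u * k2 + Y2 u * k3
  have hb := hI.norm_image_sub_le_of_norm_hasDerivWithin_le (C := 0) hder
    (fun u _ => by simp) hs ht
  rw [zero_mul] at hb
  exact sub_eq_zero.mp (norm_le_zero_iff.mp hb)
end

section
/- Let l1, l2, l3, m1, m2 be positive reals, l2 ≠ l3, c real, and set m3 = m2*l2/l3. Then for every real s, at the point (x1, x2, y1, y2) = (0, s, 0, −c*l3/(l2−l3)) the gradient of H̃ satisfies ∂H̃/∂x1 = 0, ∂H̃/∂x2 = 0, ∂H̃/∂y1 = c/(l2*m2*(l2−l3)), and ∂H̃/∂y2 = c*(l2+l3)/(l2*l3*m2*(l3−l2)). Consequently, the linearization of the energy along the particular solution gives the linear first integral h = (c/(l2l3m2(l3−l2)))·(−l3*Y1 + (l2+l3)*Y2) of the variational equations. -/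
/-- The transformed reduced Hamiltonian `H̃` of the flail pendulum in the variables
`(x1, x2, y1, y2)`. -/
noncomputable def flailHt (l1 l2 l3 m1 m2 m3 c : ℝ) (x1 x2 y1 y2 : ℝ) : ℝ :=
  (l2 ^ 2 * m2 * m3 * (c * l3 + l2 * y2 - l3 * (y1 + y2)) ^ 2
      + l1 ^ 2 * (m1 + m2 + m3) * (l2 ^ 2 * m2 * y2 ^ 2 + m3 * (l3 * y1 - l2 * y2) ^ 2)
      - l1 * (m3 * Real.cos (x1 - x2) *
            (2 * l2 ^ 2 * m2 * y2 * (c * l3 + l2 * y2 - l3 * (y1 + y2))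
              + l1 * m3 * (l3 * y1 - l2 * y2) ^ 2 * Real.cos (x1 - x2))
          + 2 * l2 * m2 * m3 * (-(l3 * y1) + l2 * y2) *
              (-(l2 * y2) + l3 * (-c + y1 + y2) + l1 * y2 * Real.cos (x1 - x2)) * Real.cos x2
          + l1 * l2 ^ 2 * m2 ^ 2 * y2 ^ 2 * Real.cos x2 ^ 2)) /
    (2 * l1 ^ 2 * l2 ^ 2 * l3 ^ 2 * m2 * m3 *
      ((m1 + m2 + m3) - m3 * Real.cos (x1 - x2) ^ 2 - m2 * Real.cos x2 ^ 2))

theorem flail_q_pos (m1 m2 m3 a b : ℝ) (hm1 : 0 < m1) (hm2 : 0 < m2) (hm3 : 0 < m3) :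
    0 < (m1 + m2 + m3) - m3 * Real.cos a ^ 2 - m2 * Real.cos b ^ 2 := by
  nlinarith [Real.cos_sq_le_one a, Real.cos_sq_le_one b]

theorem flail_x1 (l1 l2 l3 m1 m2 m3 c Y s : ℝ) (hl1 : 0 < l1) (hl2 : 0 < l2) (hl3 : 0 < l3)
    (hm1 : 0 < m1) (hm2 : 0 < m2) (hm3 : 0 < m3) (hY : c * l3 + l2 * Y - l3 * Y = 0) :
    deriv (fun u => flailHt l1 l2 l3 m1 m2 m3 c u s 0 Y) 0 = 0 := by
  have hfun : (fun u => flailHt l1 l2 l3 m1 m2 m3 c u s 0 Y) = fun u =>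
      Y ^ 2 / (2 * l3 ^ 2 * m2 * m3) *
        (((m1 + m2 + m3) * (m2 + m3) - (m3 * Real.cos (u - s) + m2 * Real.cos s) ^ 2) /
          ((m1 + m2 + m3) - m3 * Real.cos (u - s) ^ 2 - m2 * Real.cos s ^ 2)) := by
    funext u
    have hq := (flail_q_pos m1 m2 m3 (u - s) s hm1 hm2 hm3).ne'
    have h1 : c * l3 + l2 * Y - l3 * (0 + Y) = 0 := by linarith
    have h2 : -(l2 * Y) + l3 * (-c + 0 + Y) + l1 * Y * Real.cos (u - s)
      = l1 * Y * Real.cos (u - s) := by linarith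
    unfold flailHt
    rw [h1, h2]
    field_simp
    ring
  rw [hfun]
  have hc : HasDerivAt (fun u : ℝ => Real.cos (u - s)) (Real.sin s) 0 := by
    have := ((hasDerivAt_id (0 : ℝ)).sub_const s).cos
    simpa using this
  have hq := (flail_q_pos m1 m2 m3 (0 - s) s hm1 hm2 hm3).ne'
  have hn := (((hc.const_mul m3).add_const (m2 * Real.cos s)).pow 2).const_sub
    ((m1 + m2 + m3) * (m2 + m3))
  have hd := (((hc.pow 2).const_mul m3).const_sub (m1 + m2 + m3)).sub_const (m2 * Real.cos s ^ 2)
  have h := ((hn.div hd hq).const_mul (Y ^ 2 / (2 * l3 ^ 2 * m2 * m3)))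
  refine (h.congr_deriv ?_).deriv
  have : Real.cos (0 - s) = Real.cos s := by simp
  simp only [Pi.pow_apply, this]
  rw [mul_eq_zero]; right
  rw [div_eq_zero_iff]; left
  push_cast
  ring

theorem flail_zero (l1 l2 l3 m1 m2 m3 c x y : ℝ) (hl1 : 0 < l1) (hl2 : 0 < l2)
    (hl3 : 0 < l3) (hm1 : 0 < m1) (hm2 : 0 < m2) (hm3 : 0 < m3) :
    flailHt l1 l2 l3 m1 m2 m3 c 0 x 0 y =
      (c * l3 + l2 * y - l3 * y) ^ 2 / (2 * l1 ^ 2 * l3 ^ 2 *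
        ((m1 + m2 + m3) - m3 * Real.cos x ^ 2 - m2 * Real.cos x ^ 2))
      + (m2 + m3) / (2 * l3 ^ 2 * m2 * m3) * y ^ 2 := by
  have hq := (flail_q_pos m1 m2 m3 x x hm1 hm2 hm3).ne'
  have h0 : Real.cos (0 - x) = Real.cos x := by simp
  unfold flailHt
  rw [h0]
  field_simp
  ring

theorem flail_y1 (l1 l2 l3 m1 m2 m3 c Y s : ℝ) (hl1 : 0 < l1) (hl2 : 0 < l2) (hl3 : 0 < l3)
    (hm1 : 0 < m1) (hm2 : 0 < m2) (hm3 : 0 < m3) (hY : c * l3 + l2 * Y - l3 * Y = 0) :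
    deriv (fun u => flailHt l1 l2 l3 m1 m2 m3 c 0 s u Y) 0 = -Y / (l2 * l3 * m2) := by
  have hq := (flail_q_pos m1 m2 m3 s s hm1 hm2 hm3).ne'
  obtain ⟨a, b, hfun⟩ : ∃ a b : ℝ, (fun u => flailHt l1 l2 l3 m1 m2 m3 c 0 s u Y) = fun u =>
      a * u ^ 2 + -Y / (l2 * l3 * m2) * u + b := by
    refine ⟨(l2 ^ 2 * m2 * m3 * l3 ^ 2 + l1 ^ 2 * (m1 + m2 + m3) * m3 * l3 ^ 2
      - l1 ^ 2 * m3 ^ 2 * l3 ^ 2 * Real.cos s ^ 2 + 2 * l1 * l2 * m2 * m3 * l3 ^ 2 * Real.cos s) /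
      (2 * l1 ^ 2 * l2 ^ 2 * l3 ^ 2 * m2 * m3 *
      ((m1 + m2 + m3) - m3 * Real.cos s ^ 2 - m2 * Real.cos s ^ 2)),
      (m2 + m3) / (2 * l3 ^ 2 * m2 * m3) * Y ^ 2, ?_⟩
    funext u
    have h0 : Real.cos (0 - s) = Real.cos s := by simp
    have h1 : c * l3 + l2 * Y - l3 * (u + Y) = -(l3 * u) := by linarith
    have h2 : -(l2 * Y) + l3 * (-c + u + Y) + l1 * Y * Real.cos s
      = l3 * u + l1 * Y * Real.cos s := by linarith
    unfold flailHt
    rw [h0, h1, h2]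
    field_simp
    ring
  rw [hfun]
  have h := ((((hasDerivAt_id (0 : ℝ)).pow 2).const_mul a).add
    ((hasDerivAt_id (0 : ℝ)).const_mul (-Y / (l2 * l3 * m2)))).add_const b
  exact (h.congr_deriv (by simp)).deriv

theorem flail_y2 (l1 l2 l3 m1 m2 m3 c Y s : ℝ) (hl1 : 0 < l1) (hl2 : 0 < l2) (hl3 : 0 < l3)
    (hm1 : 0 < m1) (hm2 : 0 < m2) (hm3 : 0 < m3) (hY : c * l3 + l2 * Y - l3 * Y = 0) :
    deriv (fun u => flailHt l1 l2 l3 m1 m2 m3 c 0 s 0 u) Y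
      = (m2 + m3) / (l3 ^ 2 * m2 * m3) * Y := by
  simp only [flail_zero l1 l2 l3 m1 m2 m3 c _ _ hl1 hl2 hl3 hm1 hm2 hm3]
  have hi := hasDerivAt_id Y
  have hA := ((((hi.const_mul l2).const_add (c * l3)).sub (hi.const_mul l3)).pow 2).div_const
    (2 * l1 ^ 2 * l3 ^ 2 * ((m1 + m2 + m3) - m3 * Real.cos s ^ 2 - m2 * Real.cos s ^ 2))
  have h := hA.add ((hi.pow 2).const_mul ((m2 + m3) / (2 * l3 ^ 2 * m2 * m3)))
  refine (h.congr_deriv ?_).deriv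
  simp [hY]
  field_simp

/-- With `m3 = m2 l2 / l3`, at every point `(0, s, 0, -c l3/(l2-l3))` of the particular solution
the gradient of `H̃` has the indicated components; consequently the linearization of the energy
gives the linear first integral
`h = (c/(l2 l3 m2 (l3-l2)))·(-l3 Y1 + (l2+l3) Y2)` of the variational equations. -/
theorem stmt_3 (l1 l2 l3 m1 m2 c : ℝ)
    (hl1 : 0 < l1) (hl2 : 0 < l2) (hl3 : 0 < l3)
    (hm1 : 0 < m1) (hm2 : 0 < m2) (hne : l2 ≠ l3)
    (Ht : ℝ → ℝ → ℝ → ℝ → ℝ) (hHt : Ht = flailHt l1 l2 l3 m1 m2 (m2 * l2 / l3) c) :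
    ∀ s : ℝ,
      (deriv (fun u => Ht u s 0 (-c * l3 / (l2 - l3))) 0 = 0 ∧
       deriv (fun u => Ht 0 u 0 (-c * l3 / (l2 - l3))) s = 0 ∧
       deriv (fun u => Ht 0 s u (-c * l3 / (l2 - l3))) 0 = c / (l2 * m2 * (l2 - l3)) ∧
       deriv (fun u => Ht 0 s 0 u) (-c * l3 / (l2 - l3))
         = c * (l2 + l3) / (l2 * l3 * m2 * (l3 - l2)))
      ∧
      (∀ X1 X2 Y1 Y2 : ℝ,
        deriv (fun u => Ht u s 0 (-c * l3 / (l2 - l3))) 0 * X1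
          + deriv (fun u => Ht 0 u 0 (-c * l3 / (l2 - l3))) s * X2
          + deriv (fun u => Ht 0 s u (-c * l3 / (l2 - l3))) 0 * Y1
          + deriv (fun u => Ht 0 s 0 u) (-c * l3 / (l2 - l3)) * Y2
        = c / (l2 * l3 * m2 * (l3 - l2)) * (-l3 * Y1 + (l2 + l3) * Y2)) := by
  subst hHt
  intro s
  have hm3 : 0 < m2 * l2 / l3 := by positivity
  have hd : l2 - l3 ≠ 0 := sub_ne_zero.mpr hne
  have hdd : l3 - l2 ≠ 0 := sub_ne_zero.mpr hne.symm
  have hY : c * l3 + l2 * (-c * l3 / (l2 - l3)) - l3 * (-c * l3 / (l2 - l3)) = 0 := by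
    field_simp
    ring
  have e1 := flail_x1 l1 l2 l3 m1 m2 _ c _ s hl1 hl2 hl3 hm1 hm2 hm3 hY
  have e2 : deriv (fun u => flailHt l1 l2 l3 m1 m2 (m2 * l2 / l3) c 0 u 0
      (-c * l3 / (l2 - l3))) s = 0 := by
    simp only [flail_zero l1 l2 l3 m1 m2 _ c _ _ hl1 hl2 hl3 hm1 hm2 hm3, hY]
    simp
  have e3 : deriv (fun u => flailHt l1 l2 l3 m1 m2 (m2 * l2 / l3) c 0 s u
      (-c * l3 / (l2 - l3))) 0 = c / (l2 * m2 * (l2 - l3)) := by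
    rw [flail_y1 l1 l2 l3 m1 m2 _ c _ s hl1 hl2 hl3 hm1 hm2 hm3 hY]
    field_simp
  have e4 : deriv (fun u => flailHt l1 l2 l3 m1 m2 (m2 * l2 / l3) c 0 s 0 u)
      (-c * l3 / (l2 - l3)) = c * (l2 + l3) / (l2 * l3 * m2 * (l3 - l2)) := by
    rw [flail_y2 l1 l2 l3 m1 m2 _ c _ s hl1 hl2 hl3 hm1 hm2 hm3 hY]
    field_simp
    ring
  refine ⟨⟨e1, e2, e3, e4⟩, ?_⟩
  intro X1 X2 Y1 Y2
  rw [e1, e2, e3, e4]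
  have hs : l2 - l3 = -(l3 - l2) := by ring
  rw [hs]
  field_simp
  ring
end

section
/- Let l1, l2, l3, m1, m2 be positive reals, l2 ≠ l3, c real. Let x2(t) = x2(0) + c*t/(l2*m2*(l2−l3)), and suppose the C² functions X1, Y1, Y2 on a real interval I satisfy, for all t ∈ I: Ẋ1 = a11X1 + a13Y1 + a14Y2, Ẏ1 = a31X1 + a33Y1 + a34Y2, and Y2(t) = (l3/(l2+l3))·Y1(t), where the coefficients aij are evaluated at x2(t) and all denominators are nonzero on I. Then X1 satisfies the second-order equation Ẍ1 + a(x2(t))·Ẋ1 + b(x2(t))·X1 = 0, where a and b are the functions given below. -/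
/-- Denominator factor `D1(x2) = -l2 m2 - l3(m1+m2) + (l2+l3) m2 cos² x2`. -/
noncomputable def D1den (l2 l3 m1 m2 x2 : ℝ) : ℝ :=
  -(l2 * m2) - l3 * (m1 + m2) + (l2 + l3) * m2 * Real.cos x2 ^ 2

/-- Denominator factor
`F1(x2) = 4 l2² l3² m2 + l1² (l2+l3)(l3 m1 + (l2+l3) m2) + 4 l1 l2 l3 (l2+l3) m2 cos x2`. -/
noncomputable def F1den (l1 l2 l3 m1 m2 x2 : ℝ) : ℝ :=
  4 * l2 ^ 2 * l3 ^ 2 * m2 + l1 ^ 2 * (l2 + l3) * (l3 * m1 + (l2 + l3) * m2)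
    + 4 * l1 * l2 * l3 * (l2 + l3) * m2 * Real.cos x2

/-- Variational matrix entry `a11`. -/
noncomputable def a11 (l1 l2 l3 m1 m2 c x2 : ℝ) : ℝ :=
  c * (2 * l2 * l3 + l1 * (l2 + l3) * Real.cos x2) * Real.sin x2 /
    (l1 * l2 * (l2 - l3) * D1den l2 l3 m1 m2 x2)

/-- Variational matrix entry `a13`. -/
noncomputable def a13 (l1 l2 l3 m1 m2 c x2 : ℝ) : ℝ :=
  -(2 * l2 ^ 2 * l3 * m2 + l1 ^ 2 * (l3 * m1 + (l2 + l3) * m2)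
      + l1 * l2 * (l2 + 3 * l3) * m2 * Real.cos x2) /
    (l1 ^ 2 * l2 ^ 2 * m2 * D1den l2 l3 m1 m2 x2)

/-- Variational matrix entry `a14`. -/
noncomputable def a14 (l1 l2 l3 m1 m2 c x2 : ℝ) : ℝ :=
  (l2 - l3) * (2 * l2 * l3 + l1 * (l2 + l3) * Real.cos x2) /
    (l1 ^ 2 * l2 * l3 * D1den l2 l3 m1 m2 x2)

/-- Coefficient `a(x2)` of the reduced second-order equation. -/
noncomputable def acoef (l1 l2 l3 m1 m2 c x2 : ℝ) : ℝ :=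
  (4 * c * (l2 + l3) * (2 * l2 * l3 + l1 * (l2 + l3) * Real.cos x2) *
      (l1 * l3 * m1 + l1 * (l2 + l3) * m2 + 2 * l2 * l3 * m2 * Real.cos x2) * Real.sin x2) /
    (l2 * (l2 - l3) * F1den l1 l2 l3 m1 m2 x2 *
      (2 * l3 * m1 + (l2 + l3) * m2 - (l2 + l3) * m2 * Real.cos (2 * x2)))

/-- Coefficient `b(x2)` of the reduced second-order equation. -/
noncomputable def bcoef (l1 l2 l3 m1 m2 c x2 : ℝ) : ℝ :=
  (2 * c ^ 2 * (2 * l2 * l3 + l1 * (l2 + l3) * Real.cos x2) *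
      (4 * l1 * l2 * l3 * (l2 + l3) * m2
        + (4 * l2 ^ 2 * l3 ^ 2 * m2 + l1 ^ 2 * (l2 + l3) * (l3 * m1 + (l2 + l3) * m2)) *
          Real.cos x2)) /
    (l1 * l2 ^ 2 * (l2 - l3) ^ 2 * m2 * F1den l1 l2 l3 m1 m2 x2 *
      (2 * l3 * m1 + (l2 + l3) * m2 - (l2 + l3) * m2 * Real.cos (2 * x2)))


lemma aux_Dden (l2 l3 m1 m2 x : ℝ) : Dden l2 l3 m1 m2 x = 2 * D1den l2 l3 m1 m2 x := by
  unfold Dden D1den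
  rw [Real.cos_two_mul]; ring

lemma aux_Dden2 (l2 l3 m1 m2 x : ℝ) :
    2 * l3 * m1 + (l2 + l3) * m2 - (l2 + l3) * m2 * Real.cos (2 * x)
      = -2 * D1den l2 l3 m1 m2 x := by
  unfold D1den
  rw [Real.cos_two_mul]; ring

lemma aux_B (l1 l2 l3 m1 m2 c x : ℝ) (hl1 : l1 ≠ 0) (hl2 : l2 ≠ 0) (hl3 : l3 ≠ 0)
    (hm2 : m2 ≠ 0) (hs : l2 + l3 ≠ 0) (hd : D1den l2 l3 m1 m2 x ≠ 0) :
    a13 l1 l2 l3 m1 m2 c x + a14 l1 l2 l3 m1 m2 c x * (l3 / (l2 + l3)) =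
      -F1den l1 l2 l3 m1 m2 x / (l1 ^ 2 * l2 ^ 2 * m2 * (l2 + l3) * D1den l2 l3 m1 m2 x) := by
  unfold a13 a14 F1den
  generalize D1den l2 l3 m1 m2 x = d at *
  field_simp
  ring

lemma aux_E (l1 l2 l3 m1 m2 c x : ℝ) (hl1 : l1 ≠ 0) (hl2 : l2 ≠ 0) (hl3 : l3 ≠ 0)
    (hs : l2 + l3 ≠ 0) (hn : l2 - l3 ≠ 0) (hd : D1den l2 l3 m1 m2 x ≠ 0) :
    a33 l1 l2 l3 m1 m2 c x + a34 l1 l2 l3 m1 m2 c x * (l3 / (l2 + l3)) =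
      -a11 l1 l2 l3 m1 m2 c x := by
  unfold a33 a34 a11
  rw [aux_Dden]
  generalize D1den l2 l3 m1 m2 x = d at *
  field_simp
  ring

/-- x-derivative of `D1den`. -/
lemma aux_dD (l2 l3 m1 m2 x : ℝ) : HasDerivAt (D1den l2 l3 m1 m2)
    (-2 * (l2 + l3) * m2 * Real.cos x * Real.sin x) x := by
  unfold D1den
  have h := ((((Real.hasDerivAt_cos x).pow 2).const_mul ((l2 + l3) * m2)).const_add
    (-(l2 * m2) - l3 * (m1 + m2)))
  refine HasDerivAt.congr_deriv h ?_
  simp; ring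

lemma aux_dF (l1 l2 l3 m1 m2 x : ℝ) : HasDerivAt (F1den l1 l2 l3 m1 m2)
    (-4 * l1 * l2 * l3 * (l2 + l3) * m2 * Real.sin x) x := by
  unfold F1den
  have h := ((Real.hasDerivAt_cos x).const_mul (4 * l1 * l2 * l3 * (l2 + l3) * m2)).const_add
    (4 * l2 ^ 2 * l3 ^ 2 * m2 + l1 ^ 2 * (l2 + l3) * (l3 * m1 + (l2 + l3) * m2))
  refine HasDerivAt.congr_deriv h ?_
  ring

lemma aux_dA (l1 l2 l3 m1 m2 c x : ℝ) (hl1 : l1 ≠ 0) (hl2 : l2 ≠ 0)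
    (hn : l2 - l3 ≠ 0) (hd : D1den l2 l3 m1 m2 x ≠ 0) :
    HasDerivAt (a11 l1 l2 l3 m1 m2 c)
    (c / (l1 * l2 * (l2 - l3)) *
      ((-(l1 * (l2 + l3) * Real.sin x ^ 2)
        + (2 * l2 * l3 + l1 * (l2 + l3) * Real.cos x) * Real.cos x) / D1den l2 l3 m1 m2 x
      + (2 * l2 * l3 + l1 * (l2 + l3) * Real.cos x) * Real.sin x *
        (2 * (l2 + l3) * m2 * Real.cos x * Real.sin x) / D1den l2 l3 m1 m2 x ^ 2)) x := by
  unfold a11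
  have h := (((((Real.hasDerivAt_cos x).const_mul (l1 * (l2 + l3))).const_add
    (2 * l2 * l3)).const_mul c).mul (Real.hasDerivAt_sin x)).div
    ((aux_dD l2 l3 m1 m2 x).const_mul (l1 * l2 * (l2 - l3)))
    (mul_ne_zero (mul_ne_zero (mul_ne_zero hl1 hl2) hn) hd)
  refine HasDerivAt.congr_deriv h ?_
  simp only [Pi.mul_apply]
  generalize D1den l2 l3 m1 m2 x = d at *
  field_simp
  ring

lemma aux_dB (l1 l2 l3 m1 m2 x : ℝ) (hl1 : l1 ≠ 0) (hl2 : l2 ≠ 0) (hm2 : m2 ≠ 0)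
    (hs : l2 + l3 ≠ 0) (hd : D1den l2 l3 m1 m2 x ≠ 0) :
    HasDerivAt (fun x => -F1den l1 l2 l3 m1 m2 x /
        (l1 ^ 2 * l2 ^ 2 * m2 * (l2 + l3) * D1den l2 l3 m1 m2 x))
    ((4 * l1 * l2 * l3 * Real.sin x * D1den l2 l3 m1 m2 x
      - 2 * F1den l1 l2 l3 m1 m2 x * Real.cos x * Real.sin x)
      / (l1 ^ 2 * l2 ^ 2 * D1den l2 l3 m1 m2 x ^ 2)) x := by
  have h := (aux_dF l1 l2 l3 m1 m2 x).neg.div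
    ((aux_dD l2 l3 m1 m2 x).const_mul (l1 ^ 2 * l2 ^ 2 * m2 * (l2 + l3)))
    (by positivity)
  refine HasDerivAt.congr_deriv h ?_
  simp only [Pi.neg_apply]
  generalize D1den l2 l3 m1 m2 x = d at *
  generalize F1den l1 l2 l3 m1 m2 x = f at *
  field_simp

lemma aux_coefY (l1 l2 l3 m1 m2 c x : ℝ) (hl1 : l1 ≠ 0) (hl2 : l2 ≠ 0)
    (hm2 : m2 ≠ 0) (hs : l2 + l3 ≠ 0) (hn : l2 - l3 ≠ 0) (hd : D1den l2 l3 m1 m2 x ≠ 0)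
    (hf : F1den l1 l2 l3 m1 m2 x ≠ 0) :
    ((4 * l1 * l2 * l3 * Real.sin x * D1den l2 l3 m1 m2 x
      - 2 * F1den l1 l2 l3 m1 m2 x * Real.cos x * Real.sin x)
      / (l1 ^ 2 * l2 ^ 2 * D1den l2 l3 m1 m2 x ^ 2)) * (c / (l2 * m2 * (l2 - l3)))
    + acoef l1 l2 l3 m1 m2 c x *
      (-F1den l1 l2 l3 m1 m2 x /
        (l1 ^ 2 * l2 ^ 2 * m2 * (l2 + l3) * D1den l2 l3 m1 m2 x)) = 0 := by
  unfold acoef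
  rw [aux_Dden2]
  have hD : D1den l2 l3 m1 m2 x = _ := rfl
  have hF : F1den l1 l2 l3 m1 m2 x = _ := rfl
  conv at hD => rhs; unfold D1den
  conv at hF => rhs; unfold F1den
  generalize D1den l2 l3 m1 m2 x = d at *
  generalize F1den l1 l2 l3 m1 m2 x = f at *
  generalize Real.sin x = S at *
  generalize Real.cos x = C at *
  have key : 4 * l1 * l2 * l3 * d - 2 * f * C =
      -2 * (2 * l2 * l3 + l1 * (l2 + l3) * C) *
        (l1 * l3 * m1 + l1 * (l2 + l3) * m2 + 2 * l2 * l3 * m2 * C) := by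
    rw [hD, hF]; ring
  have e : 4 * l1 * l2 * l3 * S * d - 2 * f * C * S = S * (4 * l1 * l2 * l3 * d - 2 * f * C) := by
    ring
  rw [e, key]
  clear key e hD hF
  field_simp
  ring

lemma aux_coefX (l1 l2 l3 m1 m2 c x : ℝ) (hl1 : l1 ≠ 0) (hl2 : l2 ≠ 0)
    (hm2 : m2 ≠ 0) (hs : l2 + l3 ≠ 0) (hn : l2 - l3 ≠ 0) (hd : D1den l2 l3 m1 m2 x ≠ 0)
    (hf : F1den l1 l2 l3 m1 m2 x ≠ 0) :
    (c / (l1 * l2 * (l2 - l3)) *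
      ((-(l1 * (l2 + l3) * Real.sin x ^ 2)
        + (2 * l2 * l3 + l1 * (l2 + l3) * Real.cos x) * Real.cos x) / D1den l2 l3 m1 m2 x
      + (2 * l2 * l3 + l1 * (l2 + l3) * Real.cos x) * Real.sin x *
        (2 * (l2 + l3) * m2 * Real.cos x * Real.sin x) / D1den l2 l3 m1 m2 x ^ 2)) *
      (c / (l2 * m2 * (l2 - l3)))
    + a11 l1 l2 l3 m1 m2 c x ^ 2
    + (-F1den l1 l2 l3 m1 m2 x /
        (l1 ^ 2 * l2 ^ 2 * m2 * (l2 + l3) * D1den l2 l3 m1 m2 x)) * a31 l1 l2 l3 m1 m2 c x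
    + acoef l1 l2 l3 m1 m2 c x * a11 l1 l2 l3 m1 m2 c x
    + bcoef l1 l2 l3 m1 m2 c x = 0 := by
  unfold acoef bcoef a11 a31
  rw [aux_Dden2, aux_Dden]
  have hD : D1den l2 l3 m1 m2 x = _ := rfl
  have hF : F1den l1 l2 l3 m1 m2 x = _ := rfl
  conv at hD => rhs; unfold D1den
  conv at hF => rhs; unfold F1den
  generalize D1den l2 l3 m1 m2 x = d at *
  generalize F1den l1 l2 l3 m1 m2 x = f at *
  have hS := Real.sin_sq x
  generalize Real.sin x = S at *
  generalize Real.cos x = C at *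
  field_simp
  simp only [hS]
  rw [hD, hF]
  ring

/-- Elimination of `Y1, Y2` from the variational subsystem on the level `h = 0`
(`Y2 = l3/(l2+l3)·Y1`) yields the second-order equation `Ẍ1 + a Ẋ1 + b X1 = 0`. -/
theorem stmt_4 (l1 l2 l3 m1 m2 c : ℝ)
    (hl1 : 0 < l1) (hl2 : 0 < l2) (hl3 : 0 < l3)
    (hm1 : 0 < m1) (hm2 : 0 < m2) (hne : l2 ≠ l3)
    (I : Set ℝ) (hIo : IsOpen I) (hIc : Convex ℝ I)
    (x20 : ℝ) (x2 : ℝ → ℝ) (hx2 : ∀ t, x2 t = x20 + c * t / (l2 * m2 * (l2 - l3)))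
    (X1 Y1 Y2 : ℝ → ℝ)
    (hX1 : ContDiffOn ℝ 2 X1 I) (hY1 : ContDiffOn ℝ 2 Y1 I) (hY2 : ContDiffOn ℝ 2 Y2 I)
    (hD1 : ∀ t ∈ I, D1den l2 l3 m1 m2 (x2 t) ≠ 0)
    (hD : ∀ t ∈ I, Dden l2 l3 m1 m2 (x2 t) ≠ 0)
    (hF1 : ∀ t ∈ I, F1den l1 l2 l3 m1 m2 (x2 t) ≠ 0)
    (hode1 : ∀ t ∈ I, HasDerivAt X1
      (a11 l1 l2 l3 m1 m2 c (x2 t) * X1 t + a13 l1 l2 l3 m1 m2 c (x2 t) * Y1 t +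
        a14 l1 l2 l3 m1 m2 c (x2 t) * Y2 t) t)
    (hode2 : ∀ t ∈ I, HasDerivAt Y1
      (a31 l1 l2 l3 m1 m2 c (x2 t) * X1 t + a33 l1 l2 l3 m1 m2 c (x2 t) * Y1 t +
        a34 l1 l2 l3 m1 m2 c (x2 t) * Y2 t) t)
    (hlevel : ∀ t ∈ I, Y2 t = l3 / (l2 + l3) * Y1 t) :
    ∀ t ∈ I, deriv (deriv X1) t + acoef l1 l2 l3 m1 m2 c (x2 t) * deriv X1 t
        + bcoef l1 l2 l3 m1 m2 c (x2 t) * X1 t = 0 := by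
  have hl1' := hl1.ne'
  have hl2' := hl2.ne'
  have hl3' := hl3.ne'
  have hm2' := hm2.ne'
  have hs : l2 + l3 ≠ 0 := by positivity
  have hn : l2 - l3 ≠ 0 := sub_ne_zero.mpr hne
  intro t ht
  have hx : HasDerivAt x2 (c / (l2 * m2 * (l2 - l3))) t := by
    have e : x2 = fun t => x20 + c * t / (l2 * m2 * (l2 - l3)) := funext hx2
    rw [e]
    have h := (((hasDerivAt_id t).const_mul c).div_const (l2 * m2 * (l2 - l3))).const_add x20
    simpa using h
  have hX : ∀ s ∈ I, deriv X1 s = a11 l1 l2 l3 m1 m2 c (x2 s) * X1 s +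
      (-F1den l1 l2 l3 m1 m2 (x2 s) /
        (l1 ^ 2 * l2 ^ 2 * m2 * (l2 + l3) * D1den l2 l3 m1 m2 (x2 s))) * Y1 s := by
    intro s hs'
    rw [(hode1 s hs').deriv, hlevel s hs',
      ← aux_B l1 l2 l3 m1 m2 c (x2 s) hl1' hl2' hl3' hm2' hs (hD1 s hs')]
    ring
  have hY : HasDerivAt Y1 (a31 l1 l2 l3 m1 m2 c (x2 t) * X1 t
      - a11 l1 l2 l3 m1 m2 c (x2 t) * Y1 t) t := by
    have h := hode2 t ht
    rw [hlevel t ht] at h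
    convert h using 1
    linear_combination (-Y1 t) * aux_E l1 l2 l3 m1 m2 c (x2 t) hl1' hl2' hl3' hs hn (hD1 t ht)
  have hev : deriv X1 =ᶠ[nhds t] fun s => a11 l1 l2 l3 m1 m2 c (x2 s) * X1 s +
      (-F1den l1 l2 l3 m1 m2 (x2 s) /
        (l1 ^ 2 * l2 ^ 2 * m2 * (l2 + l3) * D1den l2 l3 m1 m2 (x2 s))) * Y1 s :=
    Filter.eventuallyEq_of_mem (hIo.mem_nhds ht) hX
  have hX1t := (hode1 t ht).differentiableAt.hasDerivAt
  have hA := (aux_dA l1 l2 l3 m1 m2 c (x2 t) hl1' hl2' hn (hD1 t ht)).comp t hx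
  have hB := (aux_dB l1 l2 l3 m1 m2 (x2 t) hl1' hl2' hm2' hs (hD1 t ht)).comp t hx
  have hall := (hA.mul hX1t).add (hB.mul hY)
  have hdd := (hall.congr_of_eventuallyEq hev).deriv
  have cY := aux_coefY l1 l2 l3 m1 m2 c (x2 t) hl1' hl2' hm2' hs hn (hD1 t ht) (hF1 t ht)
  have cX := aux_coefX l1 l2 l3 m1 m2 c (x2 t) hl1' hl2' hm2' hs hn (hD1 t ht) (hF1 t ht)
  rw [hdd, hX t ht]
  simp only [Function.comp_apply]
  linear_combination X1 t * cX + Y1 t * cY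
end

section
/- Let σ > 0, δ > 1 with σδ ≠ 2, set ρ = −1/σ − δ²σ/4, and let r(z) = −(3/16)[1/(z−1)² + 1/(z+1)²] − (1/4)[1/(z−δ)² + 1/(z+δ)² − 3/(z−ρ)²] + [σ³δ²(5z² − δ² − 4) + 4σ²z(4 + δ² − z²) + 4σ(20 + δ² − 5z²) + 64z]/(32σ²(z²−1)(z²−δ²)(z−ρ)). Define ω(z) = 1/(4(z−1)) + 1/(4(z+1)) + 1/(2(z−δ)) + 1/(2(z+δ)) − 1/(2(z−ρ)). Then the rational function ω'(z) + ω(z)² − r(z) is not identically zero; equivalently, the constant function P = 1 does not solve P'' + 2ωP' + (ω' + ω² − r)P = 0, so the equation w'' = r(z)w admits no exponential solution of the form w = exp(∫ω). -/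
/-- The reduced coefficient `r(z)` of the normal variational equation `w'' = r w`. -/
noncomputable def rfun (σ δ ρ : ℝ) (z : ℝ) : ℝ :=
  -(3 / 16) * (1 / (z - 1) ^ 2 + 1 / (z + 1) ^ 2)
    - (1 / 4) * (1 / (z - δ) ^ 2 + 1 / (z + δ) ^ 2 - 3 / (z - ρ) ^ 2)
    + (σ ^ 3 * δ ^ 2 * (5 * z ^ 2 - δ ^ 2 - 4) + 4 * σ ^ 2 * z * (4 + δ ^ 2 - z ^ 2)
        + 4 * σ * (20 + δ ^ 2 - 5 * z ^ 2) + 64 * z) /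
      (32 * σ ^ 2 * (z ^ 2 - 1) * (z ^ 2 - δ ^ 2) * (z - ρ))

/-- The Kovacic candidate `ω` for the exponent tuple `(1/4, 1/4, 1/2, 1/2, -1/2, 1)`. -/
noncomputable def ωfun (δ ρ : ℝ) (z : ℝ) : ℝ :=
  1 / (4 * (z - 1)) + 1 / (4 * (z + 1)) + 1 / (2 * (z - δ)) + 1 / (2 * (z + δ))
    - 1 / (2 * (z - ρ))

theorem hasDeriv_aux (δ ρ z : ℝ) (h1 : z - 1 ≠ 0) (h2 : z + 1 ≠ 0) (h3 : z - δ ≠ 0)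
    (h4 : z + δ ≠ 0) (h5 : z - ρ ≠ 0) :
    deriv (ωfun δ ρ) z = -(1 / (4 * (z - 1) ^ 2)) - 1 / (4 * (z + 1) ^ 2)
      - 1 / (2 * (z - δ) ^ 2) - 1 / (2 * (z + δ) ^ 2) + 1 / (2 * (z - ρ) ^ 2) := by
  have key : ∀ c a : ℝ, c ≠ 0 → z - a ≠ 0 →
      HasDerivAt (fun x : ℝ => 1 / (c * (x - a))) (-(1 / (c * (z - a) ^ 2))) z := by
    intro c a hc ha
    have h := (((hasDerivAt_id z).sub_const a).const_mul c).inv (mul_ne_zero hc ha)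
    simp only [one_div]
    have h' : HasDerivAt (fun x : ℝ => (c * (x - a))⁻¹) (-(c * 1) / (c * (z - a)) ^ 2) z := h
    refine h'.congr_deriv ?_
    field_simp
  have e1 := key 4 1 (by norm_num) h1
  have e2 := key 4 (-1) (by norm_num) (by simpa using h2)
  have e3 := key 2 δ (by norm_num) h3
  have e4 := key 2 (-δ) (by norm_num) (by simpa using h4)
  have e5 := key 2 ρ (by norm_num) h5
  have h := (((e1.add e2).add e3).add e4).sub e5
  simp only [sub_neg_eq_add] at h
  have h' : HasDerivAt (ωfun δ ρ) _ z := h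
  rw [h'.deriv]
  ring

/-- The numerator of `ω' + ω² - r` over `(z²-1)(z²-δ²)(z-ρ)`. -/
theorem numer_aux (σ δ ρ z : ℝ) (hσ : σ ≠ 0) (h1 : z - 1 ≠ 0) (h2 : z + 1 ≠ 0)
    (h3 : z - δ ≠ 0) (h4 : z + δ ≠ 0) (h5 : z - ρ ≠ 0)
    (h : deriv (ωfun δ ρ) z + (ωfun δ ρ z) ^ 2 - rfun σ δ ρ z = 0) :
    4 * σ ^ 2 * (z ^ 2 - δ ^ 2) * (z - ρ) + 16 * σ ^ 2 * (z ^ 2 - 1) * (z - ρ)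
      + 32 * σ ^ 2 * z ^ 2 * (z - ρ) - 16 * σ ^ 2 * z * (z ^ 2 - δ ^ 2)
      - 32 * σ ^ 2 * z * (z ^ 2 - 1)
      - (σ ^ 3 * δ ^ 2 * (5 * z ^ 2 - δ ^ 2 - 4) + 4 * σ ^ 2 * z * (4 + δ ^ 2 - z ^ 2)
        + 4 * σ * (20 + δ ^ 2 - 5 * z ^ 2) + 64 * z) = 0 := by
  rw [hasDeriv_aux δ ρ z h1 h2 h3 h4 h5] at h
  unfold ωfun rfun at h
  generalize (σ ^ 3 * δ ^ 2 * (5 * z ^ 2 - δ ^ 2 - 4) + 4 * σ ^ 2 * z * (4 + δ ^ 2 - z ^ 2)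
        + 4 * σ * (20 + δ ^ 2 - 5 * z ^ 2) + 64 * z) = Q at h ⊢
  have e1 : z ^ 2 - 1 = (z - 1) * (z + 1) := by ring
  have e2 : z ^ 2 - δ ^ 2 = (z - δ) * (z + δ) := by ring
  have hD : 32 * σ ^ 2 * (z ^ 2 - 1) * (z ^ 2 - δ ^ 2) * (z - ρ) ≠ 0 := by
    rw [e1, e2]; positivity
  have h6 := congrArg (fun t => t * (32 * σ ^ 2 * (z ^ 2 - 1) * (z ^ 2 - δ ^ 2) * (z - ρ))) h
  simp only [zero_mul] at h6
  rw [← h6, e1, e2]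
  field_simp
  ring

/-- The rational function `ω' + ω² - r` is not identically zero: `P = 1` does not solve
`P'' + 2ωP' + (ω' + ω² - r)P = 0`, so `w'' = r w` has no exponential solution `exp ∫ ω`. -/
theorem stmt_9 (σ δ ρ : ℝ)
    (hσ : 0 < σ) (hδ1 : 1 < δ) (hσδ : σ * δ ≠ 2)
    (hρ : ρ = -1 / σ - δ ^ 2 * σ / 4) :
    ∃ z : ℝ, (z ≠ 1 ∧ z ≠ -1 ∧ z ≠ δ ∧ z ≠ -δ ∧ z ≠ ρ) ∧
      deriv (ωfun δ ρ) z + (ωfun δ ρ z) ^ 2 - rfun σ δ ρ z ≠ 0 := by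
  have hρ0 : ρ < 0 := by
    have a : 0 < 1 / σ := by positivity
    have b : 0 ≤ δ ^ 2 * σ / 4 := by positivity
    have c : -1 / σ = -(1 / σ) := by ring
    rw [hρ, c]; linarith
  by_contra hcon
  push Not at hcon
  have main : ∀ t : ℝ, 0 < t → _ := fun t ht =>
    numer_aux σ δ ρ (δ + t) hσ.ne' (by intro h; linarith) (by intro h; linarith)
      (by intro h; linarith) (by intro h; linarith) (by intro h; linarith)
      (hcon (δ + t) ⟨by intro h; linarith, by intro h; linarith, by intro h; linarith,
        by intro h; linarith, by intro h; linarith⟩)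
  have a1 := main 1 (by norm_num)
  have a2 := main 2 (by norm_num)
  have a3 := main 3 (by norm_num)
  have a4 := main 4 (by norm_num)
  -- the third finite difference isolates the leading coefficient `8 σ²`
  have : 48 * σ ^ 2 = 0 := by linear_combination a4 - 3 * a3 + 3 * a2 - a1
  have : 0 < σ ^ 2 := by positivity
  linarith
end

section
/- Let l1, l2, m1, m2 be positive reals and y2 a nonzero real; set α = l1/l2 and γ = m1/m2. For every real x2 such that all denominators below are nonzero, putting z = cos x2, zdot = y2*sin x2/(l2²*m2) and zddot = −y2²*cos x2/(l2⁴*m2²), one has the two identities zddot + a(x2)·zdot = zdot²·p(z) and b(x2) = zdot²·q(z). Hence along the particular solution with ẋ2 = −y2/(l2²m2), the change of variable t ↦ z = cos x2(t) transforms Ẍ + a Ẋ + b X = 0 into X'' + p(z)X' + q(z)X = 0. -/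
/-- Coefficient `a(x2)` of the second-order variational equation
(case `l3 = l2`, `m3 = m2`, `c = 0`). -/
noncomputable def acoef2 (l1 l2 m1 m2 y2 x2 : ℝ) : ℝ :=
  -4 * y2 * (l2 + l1 * Real.cos x2) * (l1 * (m1 + 2 * m2) + 2 * l2 * m2 * Real.cos x2) *
      Real.sin x2 /
    (l2 ^ 2 * (2 * l2 ^ 2 * m2 + l1 ^ 2 * (m1 + 2 * m2) + 4 * l1 * l2 * m2 * Real.cos x2) *
      (m1 + m2 - m2 * Real.cos (2 * x2)))

/-- Coefficient `b(x2)` of the second-order variational equation. -/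
noncomputable def bcoef2 (l1 l2 m1 m2 y2 x2 : ℝ) : ℝ :=
  2 * y2 ^ 2 * (l2 + l1 * Real.cos x2) *
      (4 * l1 * l2 * m2 + (2 * l2 ^ 2 * m2 + l1 ^ 2 * (m1 + 2 * m2)) * Real.cos x2) /
    (l1 * l2 ^ 4 * m2 * (2 * l2 ^ 2 * m2 + l1 ^ 2 * (m1 + 2 * m2)
        + 4 * l1 * l2 * m2 * Real.cos x2) *
      (m1 + m2 - m2 * Real.cos (2 * x2)))

/-- Rational coefficient `p(z)` (with `α = l1/l2`, `γ = m1/m2`). -/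
noncomputable def pcoef2 (α γ z : ℝ) : ℝ :=
  (-8 * z ^ 2 * α + 16 * z ^ 4 * α - 4 * α * (2 + γ) + 6 * z ^ 3 * (2 + α ^ 2 * (2 + γ))
      - z * (6 + γ) * (2 + α ^ 2 * (2 + γ))) /
    ((z ^ 2 - 1) * (-2 + 2 * z ^ 2 - γ) * (2 + 4 * z * α + α ^ 2 * (2 + γ)))

/-- Rational coefficient `q(z)` (with `α = l1/l2`, `γ = m1/m2`). -/
noncomputable def qcoef2 (α γ z : ℝ) : ℝ :=
  2 * (1 + z * α) * (4 * α + z * (2 + α ^ 2 * (2 + γ))) /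
    ((z ^ 2 - 1) * α * (-2 + 2 * z ^ 2 - γ) * (2 + 4 * z * α + α ^ 2 * (2 + γ)))

/-- Along the particular solution with `ẋ2 = -y2/(l2² m2)`, the change of variable
`z = cos x2` transforms `Ẍ + a Ẋ + b X = 0` into `X'' + p X' + q X = 0`. -/
theorem stmt_11 (l1 l2 m1 m2 y2 : ℝ)
    (hl1 : 0 < l1) (hl2 : 0 < l2) (hm1 : 0 < m1) (hm2 : 0 < m2) (hy2 : y2 ≠ 0) :
    ∀ x2 : ℝ,
      2 * l2 ^ 2 * m2 + l1 ^ 2 * (m1 + 2 * m2) + 4 * l1 * l2 * m2 * Real.cos x2 ≠ 0 →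
      m1 + m2 - m2 * Real.cos (2 * x2) ≠ 0 →
      Real.cos x2 ^ 2 - 1 ≠ 0 →
      -2 + 2 * Real.cos x2 ^ 2 - m1 / m2 ≠ 0 →
      2 + 4 * Real.cos x2 * (l1 / l2) + (l1 / l2) ^ 2 * (2 + m1 / m2) ≠ 0 →
      (-(y2 ^ 2 * Real.cos x2 / (l2 ^ 4 * m2 ^ 2))
          + acoef2 l1 l2 m1 m2 y2 x2 * (y2 * Real.sin x2 / (l2 ^ 2 * m2))
        = (y2 * Real.sin x2 / (l2 ^ 2 * m2)) ^ 2 *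
            pcoef2 (l1 / l2) (m1 / m2) (Real.cos x2)) ∧
      (bcoef2 l1 l2 m1 m2 y2 x2
        = (y2 * Real.sin x2 / (l2 ^ 2 * m2)) ^ 2 *
            qcoef2 (l1 / l2) (m1 / m2) (Real.cos x2)) := by
  intro x2 hD hM hz hG hE
  have hs : Real.sin x2 ^ 2 = 1 - Real.cos x2 ^ 2 := by
    have := Real.sin_sq_add_cos_sq x2
    linarith
  unfold acoef2 bcoef2 pcoef2 qcoef2
  rw [Real.cos_two_mul] at *
  generalize Real.cos x2 = z at *
  generalize Real.sin x2 = s at *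
  obtain ⟨α, rfl⟩ : ∃ α, l1 = α * l2 := ⟨l1 / l2, by field_simp⟩
  obtain ⟨γ, rfl⟩ : ∃ γ, m1 = γ * m2 := ⟨m1 / m2, by field_simp⟩
  have hl : l2 ≠ 0 := hl2.ne'
  have hm : m2 ≠ 0 := hm2.ne'
  have hα : α ≠ 0 := by
    rintro rfl
    simp at hl1
  rw [mul_div_cancel_right₀ _ hl, mul_div_cancel_right₀ _ hm] at *
  have e1 : 2 * l2 ^ 2 * m2 + (α * l2) ^ 2 * (γ * m2 + 2 * m2) + 4 * (α * l2) * l2 * m2 * z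
      = l2 ^ 2 * m2 * (2 + 4 * z * α + α ^ 2 * (2 + γ)) := by ring
  have e2 : γ * m2 + m2 - m2 * (2 * z ^ 2 - 1) = -(m2 * (-2 + 2 * z ^ 2 - γ)) := by ring
  rw [e1, e2]
  have e3 : (y2 * s / (l2 ^ 2 * m2)) ^ 2 = -(y2 ^ 2 * (z ^ 2 - 1) / (l2 ^ 4 * m2 ^ 2)) := by
    rw [div_pow, mul_pow, hs]
    field_simp
    ring
  rw [e3]
  generalize hEE : 2 + 4 * z * α + α ^ 2 * (2 + γ) = E at *
  generalize hGG : -2 + 2 * z ^ 2 - γ = G at *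
  generalize hZZ : z ^ 2 - 1 = Z at *
  have hs' : s ^ 2 = -Z := by rw [hs, ← hZZ]; ring
  constructor
  · field_simp
    rw [hs', ← hEE, ← hGG, ← hZZ]
    ring
  · field_simp
    ring
end

section
/- Let α > 0 and γ > 0, set δ = sqrt(1 + γ/2) (so δ > 1), assume αδ ≠ 1, and set z5 = −(1 + α²δ²)/(2α). Define r(z) = −q(z) + p'(z)/2 + p(z)²/4, where p(z) = [−8z²α + 16z⁴α − 4α(2 + γ) + 6z³(2 + α²(2 + γ)) − z(6 + γ)(2 + α²(2 + γ))]/[(z²−1)(−2 + 2z² − γ)(2 + 4zα + α²(2 + γ))] and q(z) = 2(1 + zα)(4α + z(2 + α²(2 + γ)))/[(z²−1)α(−2 + 2z² − γ)(2 + 4zα + α²(2 + γ))]. Then: (i) the five points 1, −1, δ, −δ, z5 are pairwise distinct; (ii) (z−1)²r(z) → −3/16 as z → 1 and (z+1)²r(z) → −3/16 as z → −1; (iii) (z−δ)²r(z) → −1/4 as z → δ and (z+δ)²r(z) → −1/4 as z → −δ; (iv) (z−z5)²r(z) → 3/4 as z → z5; (v) z²r(z) → 0 as z → ∞. In particular,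 the exponent differences of w'' = r(z)w at ±1, ±δ, z5, ∞ are 1/2, 1/2, 0, 0, 2, 1 respectively. -/
/-- The reduced (Tschirnhaus) coefficient `r = -q + p'/2 + p²/4`. -/
noncomputable def rred2 (α γ : ℝ) (z : ℝ) : ℝ :=
  -qcoef2 α γ z + deriv (pcoef2 α γ) z / 2 + (pcoef2 α γ z) ^ 2 / 4

/-- Partial fraction form of `p`. -/
theorem pcoef2_form (α γ δ z5 z : ℝ) (hα : 0 < α) (hg : γ = 2 * δ ^ 2 - 2)
    (hz5 : z5 = -(1 + α ^ 2 * δ ^ 2) / (2 * α))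
    (h1 : z - 1 ≠ 0) (h2 : z + 1 ≠ 0) (h3 : z - δ ≠ 0) (h4 : z + δ ≠ 0) (h5 : z - z5 ≠ 0) :
    pcoef2 α γ z = (1 / 2) / (z - 1) + (1 / 2) / (z + 1) + 1 / (z - δ) + 1 / (z + δ)
      + (-1) / (z - z5) := by
  have hα' := hα.ne'
  have e : (z ^ 2 - 1) * (-2 + 2 * z ^ 2 - γ) * (2 + 4 * z * α + α ^ 2 * (2 + γ))
      = 8 * α * ((z - 1) * (z + 1) * (z - δ) * (z + δ) * (z - z5)) := by
    rw [hz5, hg]; field_simp; ring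
  have h : α ^ 2 * δ ^ 2 = - 2 * α * z5 - 1 := by rw [hz5]; field_simp; ring
  unfold pcoef2
  rw [e, div_eq_iff (by positivity), hg]
  field_simp
  linear_combination (24 * z ^ 3 - 8 * z * (2 + δ ^ 2)) * h

theorem qcoef2_form (α γ δ z5 z : ℝ) (hα : 0 < α) (hg : γ = 2 * δ ^ 2 - 2)
    (hz5 : z5 = -(1 + α ^ 2 * δ ^ 2) / (2 * α)) :
    qcoef2 α γ z = ((1 + z * α) * (4 * α + z * (2 + α ^ 2 * (2 + γ))) / (4 * α ^ 2)) /
      ((z - 1) * (z + 1) * (z - δ) * (z + δ) * (z - z5)) := by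
  have hα' := hα.ne'
  have e : (z ^ 2 - 1) * α * (-2 + 2 * z ^ 2 - γ) * (2 + 4 * z * α + α ^ 2 * (2 + γ))
      = 8 * α ^ 2 * ((z - 1) * (z + 1) * (z - δ) * (z + δ) * (z - z5)) := by
    rw [hz5, hg]; field_simp; ring
  unfold qcoef2
  rw [e, div_div]
  rw [show 8 * α ^ 2 * ((z - 1) * (z + 1) * (z - δ) * (z + δ) * (z - z5)) =
    2 * (4 * α ^ 2 * ((z - 1) * (z + 1) * (z - δ) * (z + δ) * (z - z5))) by ring, mul_assoc 2,
    mul_div_mul_left _ _ two_ne_zero]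

theorem hasDerivAt_simple (A c z : ℝ) (h : z - c ≠ 0) :
    HasDerivAt (fun z : ℝ => A / (z - c)) (-(A / (z - c) ^ 2)) z := by
  have := (((hasDerivAt_id z).sub_const c).fun_inv h).const_mul A
  simp only [id] at this
  have e : A * (-1 / (z - c) ^ 2) = -(A / (z - c) ^ 2) := by ring
  rw [e] at this
  simpa only [div_eq_mul_inv] using this

open Filter Topology in
theorem pcoef2_deriv (α γ δ z5 z : ℝ) (hα : 0 < α) (hg : γ = 2 * δ ^ 2 - 2)
    (hz5 : z5 = -(1 + α ^ 2 * δ ^ 2) / (2 * α))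
    (h1 : z - 1 ≠ 0) (h2 : z + 1 ≠ 0) (h3 : z - δ ≠ 0) (h4 : z + δ ≠ 0) (h5 : z - z5 ≠ 0) :
    deriv (pcoef2 α γ) z = -((1 / 2) / (z - 1) ^ 2) + -((1 / 2) / (z + 1) ^ 2)
      + -(1 / (z - δ) ^ 2) + -(1 / (z + δ) ^ 2) + -((-1) / (z - z5) ^ 2) := by
  have key : pcoef2 α γ =ᶠ[𝓝 z] fun z => (1 / 2) / (z - 1) + (1 / 2) / (z - (-1)) + 1 / (z - δ)
      + 1 / (z - (-δ)) + (-1) / (z - z5) := by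
    have c1 : ∀ c : ℝ, z - c ≠ 0 → ∀ᶠ y in 𝓝 z, y - c ≠ 0 := fun c hc =>
      (continuous_id.sub continuous_const).continuousAt.eventually_ne hc
    filter_upwards [c1 1 h1, c1 (-1) (by simpa using h2), c1 δ h3, c1 (-δ) (by simpa using h4),
      c1 z5 h5] with y g1 g2 g3 g4 g5
    simp only [sub_neg_eq_add] at *
    exact pcoef2_form α γ δ z5 y hα hg hz5 g1 g2 g3 g4 g5
  rw [key.deriv_eq]
  have := ((((hasDerivAt_simple (1/2) 1 z h1).add
    (hasDerivAt_simple (1/2) (-1) z (by simpa using h2))).add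
    (hasDerivAt_simple 1 δ z h3)).add (hasDerivAt_simple 1 (-δ) z (by simpa using h4))).add
    (hasDerivAt_simple (-1) z5 z h5)
  refine (this.deriv.trans ?_)
  simp only [sub_neg_eq_add]

/-- The local limit at one of five distinct points. -/
theorem local_limit (r N : ℝ → ℝ) (A B1 B2 B3 B4 c c1 c2 c3 c4 : ℝ) (hN : Continuous N)
    (n1 : c ≠ c1) (n2 : c ≠ c2) (n3 : c ≠ c3) (n4 : c ≠ c4)
    (hr : ∀ z, z - c ≠ 0 → z - c1 ≠ 0 → z - c2 ≠ 0 → z - c3 ≠ 0 → z - c4 ≠ 0 →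
      r z = -(N z / ((z - c) * (z - c1) * (z - c2) * (z - c3) * (z - c4)))
        + (-(A / (z - c) ^ 2) + -(B1 / (z - c1) ^ 2) + -(B2 / (z - c2) ^ 2)
          + -(B3 / (z - c3) ^ 2) + -(B4 / (z - c4) ^ 2)) / 2
        + (A / (z - c) + B1 / (z - c1) + B2 / (z - c2) + B3 / (z - c3) + B4 / (z - c4)) ^ 2 / 4) :
    Filter.Tendsto (fun z => (z - c) ^ 2 * r z) (nhdsWithin c {c}ᶜ)
      (nhds (-A / 2 + A ^ 2 / 4)) := by
  have m1 := sub_ne_zero.2 n1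
  have m2 := sub_ne_zero.2 n2
  have m3 := sub_ne_zero.2 n3
  have m4 := sub_ne_zero.2 n4
  let G : ℝ → ℝ := fun z =>
    -((z - c) * N z / ((z - c1) * (z - c2) * (z - c3) * (z - c4)))
    + (-A + (z - c) ^ 2 * (-(B1 / (z - c1) ^ 2) + -(B2 / (z - c2) ^ 2)
          + -(B3 / (z - c3) ^ 2) + -(B4 / (z - c4) ^ 2))) / 2
    + (A + (z - c) * (B1 / (z - c1) + B2 / (z - c2) + B3 / (z - c3) + B4 / (z - c4))) ^ 2 / 4
  have hG : ContinuousAt G c := by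
    have := hN.continuousAt (x := c)
    have m : (c - c1) * (c - c2) * (c - c3) * (c - c4) ≠ 0 := by positivity
    have k1 := pow_ne_zero 2 m1
    have k2 := pow_ne_zero 2 m2
    have k3 := pow_ne_zero 2 m3
    have k4 := pow_ne_zero 2 m4
    fun_prop (disch := assumption)
  have hGc : G c = -A / 2 + A ^ 2 / 4 := by simp [G]
  rw [← hGc]
  refine (hG.tendsto.mono_left nhdsWithin_le_nhds).congr' ?_
  have ev : ∀ d : ℝ, c - d ≠ 0 → ∀ᶠ y in nhdsWithin c {c}ᶜ, y - d ≠ 0 := fun d hd =>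
    ((continuous_id.sub continuous_const).continuousAt.eventually_ne hd).filter_mono
      nhdsWithin_le_nhds
  filter_upwards [self_mem_nhdsWithin, ev c1 m1, ev c2 m2, ev c3 m3, ev c4 m4]
    with z g0 g1 g2 g3 g4
  have g0' : z - c ≠ 0 := sub_ne_zero.2 g0
  rw [hr z g0' g1 g2 g3 g4]
  have e1 : (z - c) ^ 2 * (N z / ((z - c) * (z - c1) * (z - c2) * (z - c3) * (z - c4))) =
      (z - c) * N z / ((z - c1) * (z - c2) * (z - c3) * (z - c4)) := by
    field_simp
  have e2 : (z - c) ^ 2 * (A / (z - c) ^ 2) = A := by field_simp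
  have e3 : (z - c) * (A / (z - c)) = A := by field_simp
  simp only [G]
  rw [← e1]
  generalize N z / ((z - c) * (z - c1) * (z - c2) * (z - c3) * (z - c4)) = u
  have : (A / (z - c) + B1 / (z - c1) + B2 / (z - c2) + B3 / (z - c3) + B4 / (z - c4)) =
    A / (z - c) + (B1 / (z - c1) + B2 / (z - c2) + B3 / (z - c3) + B4 / (z - c4)) := by ring
  rw [this]
  generalize (B1 / (z - c1) + B2 / (z - c2) + B3 / (z - c3) + B4 / (z - c4)) = v
  generalize A / (z - c) ^ 2 = a at *
  generalize A / (z - c) = b at *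
  generalize B1 / (z - c1) ^ 2 = b1
  generalize B2 / (z - c2) ^ 2 = b2
  generalize B3 / (z - c3) ^ 2 = b3
  generalize B4 / (z - c4) ^ 2 = b4
  have e3' : (A + (z - c) * v) = (z - c) * (b + v) := by rw [mul_add, e3]
  rw [e3']
  linear_combination (1 / 2) * e2


/-- The limit at infinity. -/
theorem infinity_limit (r : ℝ → ℝ) (a b s k d z5 : ℝ)
    (hr : ∀ z, z - 1 ≠ 0 → z + 1 ≠ 0 → z - d ≠ 0 → z + d ≠ 0 → z - z5 ≠ 0 →
      r z = -(((1 + z * a) * (b + z * s) / k) /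
          ((z - 1) * (z + 1) * (z - d) * (z + d) * (z - z5)))
        + (-((1 / 2) / (z - 1) ^ 2) + -((1 / 2) / (z + 1) ^ 2)
      + -(1 / (z - d) ^ 2) + -(1 / (z + d) ^ 2) + -((-1) / (z - z5) ^ 2)) / 2
        + ((1 / 2) / (z - 1) + (1 / 2) / (z + 1) + 1 / (z - d) + 1 / (z + d)
      + (-1) / (z - z5)) ^ 2 / 4) :
    Filter.Tendsto (fun z => z ^ 2 * r z) Filter.atTop (nhds 0) := by
  let G : ℝ → ℝ := fun w =>
    -(w * ((w + a) * (b * w + s) / k) *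
      ((1 - w)⁻¹ * (1 + w)⁻¹ * (1 - d * w)⁻¹ * (1 + d * w)⁻¹ * (1 - z5 * w)⁻¹))
    + (-((1 / 2) * (1 - w)⁻¹ ^ 2) + -((1 / 2) * (1 + w)⁻¹ ^ 2) + -((1 - d * w)⁻¹ ^ 2)
      + -((1 + d * w)⁻¹ ^ 2) + (1 - z5 * w)⁻¹ ^ 2) / 2
    + ((1 / 2) * (1 - w)⁻¹ + (1 / 2) * (1 + w)⁻¹ + (1 - d * w)⁻¹
      + (1 + d * w)⁻¹ - (1 - z5 * w)⁻¹) ^ 2 / 4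
  have hG : ContinuousAt G 0 := by
    have q1 : (1 - (0:ℝ)) ≠ 0 := by norm_num
    have q2 : (1 + (0:ℝ)) ≠ 0 := by norm_num
    have q3 : (1 - d * (0:ℝ)) ≠ 0 := by norm_num
    have q4 : (1 + d * (0:ℝ)) ≠ 0 := by norm_num
    have q5 : (1 - z5 * (0:ℝ)) ≠ 0 := by norm_num
    fun_prop (disch := assumption)
  have hG0 : G 0 = 0 := by simp [G]; norm_num
  rw [← hG0]
  refine (hG.tendsto.comp tendsto_inv_atTop_zero).congr' ?_
  filter_upwards [Filter.eventually_gt_atTop 0, Filter.eventually_gt_atTop 1,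
    Filter.eventually_gt_atTop (-1), Filter.eventually_gt_atTop d,
    Filter.eventually_gt_atTop (-d), Filter.eventually_gt_atTop z5] with z g0 g1 g2 g3 g4 g5
  have h1 : z - 1 ≠ 0 := ne_of_gt (by linarith)
  have h2 : z + 1 ≠ 0 := ne_of_gt (by linarith)
  have h3 : z - d ≠ 0 := ne_of_gt (by linarith)
  have h4 : z + d ≠ 0 := ne_of_gt (by linarith)
  have h5 : z - z5 ≠ 0 := ne_of_gt (by linarith)
  rw [hr z h1 h2 h3 h4 h5]
  have i1 : (1 - z⁻¹)⁻¹ = z * (z - 1)⁻¹ := by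
    rw [show 1 - z⁻¹ = (z - 1) / z by field_simp, inv_div, div_eq_mul_inv]
  have i2 : (1 + z⁻¹)⁻¹ = z * (z + 1)⁻¹ := by
    rw [show 1 + z⁻¹ = (z + 1) / z by field_simp, inv_div, div_eq_mul_inv]
  have i3 : (1 - d * z⁻¹)⁻¹ = z * (z - d)⁻¹ := by
    rw [show 1 - d * z⁻¹ = (z - d) / z by field_simp, inv_div, div_eq_mul_inv]
  have i4 : (1 + d * z⁻¹)⁻¹ = z * (z + d)⁻¹ := by
    rw [show 1 + d * z⁻¹ = (z + d) / z by field_simp, inv_div, div_eq_mul_inv]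
  have i5 : (1 - z5 * z⁻¹)⁻¹ = z * (z - z5)⁻¹ := by
    rw [show 1 - z5 * z⁻¹ = (z - z5) / z by field_simp, inv_div, div_eq_mul_inv]
  simp only [G, Function.comp]
  rw [i1, i2, i3, i4, i5]
  have j : z⁻¹ * ((z⁻¹ + a) * (b * z⁻¹ + s) / k) * z ^ 3 = (1 + z * a) * (b + z * s) / k := by
    field_simp
  simp only [div_eq_mul_inv _ (_ * _), mul_inv, div_eq_mul_inv _ ((_ : ℝ) ^ 2), ← inv_pow,
    div_eq_mul_inv _ (z - _), div_eq_mul_inv _ (z + _)]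
  generalize (z - 1)⁻¹ = x1
  generalize (z + 1)⁻¹ = x2
  generalize (z - d)⁻¹ = x3
  generalize (z + d)⁻¹ = x4
  generalize (z - z5)⁻¹ = x5
  rw [← j]
  ring

open Filter Topology in
/-- The equation `w'' = r(z) w` (case `l3 = l2`, `m3 = m2`, `c = 0`) has singular points
`±1, ±δ, z5, ∞` with the indicated leading coefficients and exponent differences. -/
theorem stmt_12 (α γ δ z5 : ℝ)
    (hα : 0 < α) (hγ : 0 < γ)
    (hδ : δ = Real.sqrt (1 + γ / 2)) (hαδ : α * δ ≠ 1)
    (hz5 : z5 = -(1 + α ^ 2 * δ ^ 2) / (2 * α)) :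
    -- (i) the five finite singular points are pairwise distinct
    (1 < δ ∧ List.Pairwise (· ≠ ·) [(1 : ℝ), -1, δ, -δ, z5]) ∧
    -- (ii)
    Tendsto (fun z => (z - 1) ^ 2 * rred2 α γ z) (𝓝[≠] 1) (𝓝 (-(3 / 16))) ∧
    Tendsto (fun z => (z + 1) ^ 2 * rred2 α γ z) (𝓝[≠] (-1)) (𝓝 (-(3 / 16))) ∧
    -- (iii)
    Tendsto (fun z => (z - δ) ^ 2 * rred2 α γ z) (𝓝[≠] δ) (𝓝 (-(1 / 4))) ∧
    Tendsto (fun z => (z + δ) ^ 2 * rred2 α γ z) (𝓝[≠] (-δ)) (𝓝 (-(1 / 4))) ∧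
    -- (iv)
    Tendsto (fun z => (z - z5) ^ 2 * rred2 α γ z) (𝓝[≠] z5) (𝓝 (3 / 4)) ∧
    -- (v)
    Tendsto (fun z => z ^ 2 * rred2 α γ z) atTop (𝓝 0) ∧
    -- exponent differences `√(1+4a)` at `±1, ±δ, z5, ∞`
    (Real.sqrt (1 + 4 * (-(3 / 16))) = 1 / 2 ∧
     Real.sqrt (1 + 4 * (-(1 / 4))) = 0 ∧
     Real.sqrt (1 + 4 * (3 / 4)) = 2 ∧
     Real.sqrt (1 + 4 * 0) = 1) := by
  have hs : δ ^ 2 = 1 + γ / 2 := by rw [hδ]; exact Real.sq_sqrt (by positivity)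
  have hδ0 : 0 ≤ δ := by rw [hδ]; exact Real.sqrt_nonneg _
  have hg : γ = 2 * δ ^ 2 - 2 := by linarith
  have hδ1 : 1 < δ := by nlinarith
  have hzz : 2 * α * z5 = -(1 + α ^ 2 * δ ^ 2) := by rw [hz5]; field_simp
  have hz5δ : z5 < -δ := by
    have : 0 < (α * δ - 1) ^ 2 := by
      have := sub_ne_zero.2 hαδ
      positivity
    nlinarith
  have hr : ∀ z, z - 1 ≠ 0 → z + 1 ≠ 0 → z - δ ≠ 0 → z + δ ≠ 0 → z - z5 ≠ 0 →
      rred2 α γ z = -(((1 + z * α) * (4 * α + z * (2 + α ^ 2 * (2 + γ))) / (4 * α ^ 2)) /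
          ((z - 1) * (z + 1) * (z - δ) * (z + δ) * (z - z5)))
        + (-((1 / 2) / (z - 1) ^ 2) + -((1 / 2) / (z + 1) ^ 2)
      + -(1 / (z - δ) ^ 2) + -(1 / (z + δ) ^ 2) + -((-1) / (z - z5) ^ 2)) / 2
        + ((1 / 2) / (z - 1) + (1 / 2) / (z + 1) + 1 / (z - δ) + 1 / (z + δ)
      + (-1) / (z - z5)) ^ 2 / 4 := by
    intro z h1 h2 h3 h4 h5
    unfold rred2
    rw [pcoef2_deriv α γ δ z5 z hα hg hz5 h1 h2 h3 h4 h5,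
      pcoef2_form α γ δ z5 z hα hg hz5 h1 h2 h3 h4 h5, qcoef2_form α γ δ z5 z hα hg hz5]
  let N : ℝ → ℝ := fun z => (1 + z * α) * (4 * α + z * (2 + α ^ 2 * (2 + γ))) / (4 * α ^ 2)
  have hN : Continuous N := by fun_prop
  refine ⟨⟨hδ1, ?_⟩, ?_, ?_, ?_, ?_, ?_, ?_, ?_, ?_, ?_, ?_⟩
  · simp only [List.pairwise_cons, List.mem_cons, List.not_mem_nil, or_false, forall_eq_or_imp,
      forall_eq, List.Pairwise.nil, and_true, false_imp_iff, implies_true]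
    refine ⟨⟨?_, ?_, ?_, ?_⟩, ⟨?_, ?_, ?_⟩, ⟨?_, ?_⟩, ?_⟩ <;> intro h <;> linarith
  · have := local_limit (rred2 α γ) N (1 / 2) (1 / 2) 1 1 (-1) 1 (-1) δ (-δ) z5 hN
      (by intro h; linarith) (by intro h; linarith) (by intro h; linarith) (by intro h; linarith)
      (by
        intro z h1 h2 h3 h4 h5
        simp only [sub_neg_eq_add] at *
        rw [hr z h1 h2 h3 h4 h5]
        try simp only [N]
        try ring)
    try simp only [sub_neg_eq_add] at this
    convert this using 2
    norm_num
  · have := local_limit (rred2 α γ) N (1 / 2) (1 / 2) 1 1 (-1) (-1) 1 δ (-δ) z5 hN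
      (by intro h; linarith) (by intro h; linarith) (by intro h; linarith) (by intro h; linarith)
      (by
        intro z h2 h1 h3 h4 h5
        simp only [sub_neg_eq_add] at *
        rw [hr z h1 h2 h3 h4 h5]
        try simp only [N]
        try ring)
    try simp only [sub_neg_eq_add] at this
    convert this using 2
    norm_num
  · have := local_limit (rred2 α γ) N 1 (1 / 2) (1 / 2) 1 (-1) δ 1 (-1) (-δ) z5 hN
      (by intro h; linarith) (by intro h; linarith) (by intro h; linarith) (by intro h; linarith)
      (by
        intro z h3 h1 h2 h4 h5
        simp only [sub_neg_eq_add] at *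
        rw [hr z h1 h2 h3 h4 h5]
        try simp only [N]
        try ring)
    try simp only [sub_neg_eq_add] at this
    convert this using 2
    norm_num
  · have := local_limit (rred2 α γ) N 1 (1 / 2) (1 / 2) 1 (-1) (-δ) 1 (-1) δ z5 hN
      (by intro h; linarith) (by intro h; linarith) (by intro h; linarith) (by intro h; linarith)
      (by
        intro z h4 h1 h2 h3 h5
        simp only [sub_neg_eq_add] at *
        rw [hr z h1 h2 h3 h4 h5]
        try simp only [N]
        try ring)
    try simp only [sub_neg_eq_add] at this
    convert this using 2
    norm_num
  · have := local_limit (rred2 α γ) N (-1) (1 / 2) (1 / 2) 1 1 z5 1 (-1) δ (-δ) hN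
      (by intro h; linarith) (by intro h; linarith) (by intro h; linarith) (by intro h; linarith)
      (by
        intro z h5 h1 h2 h3 h4
        simp only [sub_neg_eq_add] at *
        rw [hr z h1 h2 h3 h4 h5]
        try simp only [N]
        try ring)
    try simp only [sub_neg_eq_add] at this
    convert this using 2
    norm_num
  · exact infinity_limit _ α (4 * α) (2 + α ^ 2 * (2 + γ)) (4 * α ^ 2) δ z5 hr
  · rw [show (1 + 4 * (-(3 / 16)) : ℝ) = (1 / 2) ^ 2 by norm_num]
    exact Real.sqrt_sq (by norm_num)
  · norm_num
  · rw [show (1 + 4 * (3 / 4) : ℝ) = 2 ^ 2 by norm_num]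
    exact Real.sqrt_sq (by norm_num)
  · norm_num
end

section
/- Let α > 0 and γ > 0, set δ = sqrt(1 + γ/2), assume αδ ≠ 1, and set z5 = −(1 + α²δ²)/(2α). Let r(z) = −q(z) + p'(z)/2 + p(z)²/4 with p, q as in the context, and define ω(z) = 1/(4(z−1)) + 1/(4(z+1)) + 1/(2(z−δ)) + 1/(2(z+δ)) − 1/(2(z−z5)). Then the rational function ω'(z) + ω(z)² − r(z) is not identically zero; equivalently, P = 1 does not solve P'' + 2ωP' + (ω' + ω² − r)P = 0, so w'' = r(z)w admits no exponential solution exp(∫ω) with this ω. -/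
/-- The Kovacic candidate `ω` for the exponent tuple `(1/4, 1/4, 1/2, 1/2, -1/2, 1)`. -/
noncomputable def ωfun2 (δ z5 : ℝ) (z : ℝ) : ℝ :=
  1 / (4 * (z - 1)) + 1 / (4 * (z + 1)) + 1 / (2 * (z - δ)) + 1 / (2 * (z + δ))
    - 1 / (2 * (z - z5))

/-- The rational function `ω' + ω² - r` is not identically zero: `P = 1` does not solve
`P'' + 2ωP' + (ω' + ω² - r)P = 0`, so `w'' = r w` has no exponential solution `exp ∫ ω`. -/
theorem stmt_13 (α γ δ z5 : ℝ)
    (hα : 0 < α) (hγ : 0 < γ)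
    (hδ : δ = Real.sqrt (1 + γ / 2)) (hαδ : α * δ ≠ 1)
    (hz5 : z5 = -(1 + α ^ 2 * δ ^ 2) / (2 * α)) :
    ∃ z : ℝ, (z ≠ 1 ∧ z ≠ -1 ∧ z ≠ δ ∧ z ≠ -δ ∧ z ≠ z5) ∧
      deriv (ωfun2 δ z5) z + (ωfun2 δ z5 z) ^ 2 - rred2 α γ z ≠ 0 := by
  have hδ2 : δ ^ 2 = 1 + γ / 2 := by rw [hδ, Real.sq_sqrt (by linarith)]
  have hδ0 : 0 ≤ δ := by rw [hδ]; exact Real.sqrt_nonneg _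
  have hδ1 : 1 < δ := by nlinarith
  have hγ' : γ = 2 * δ ^ 2 - 2 := by linarith
  have hz5neg : z5 < 0 := by
    rw [hz5]; exact div_neg_of_neg_of_pos (by nlinarith [sq_nonneg (α * δ)]) (by linarith)
  -- beyond `δ` the coefficient `p` is exactly `2 ω`
  have key : ∀ w : ℝ, δ < w → pcoef2 α γ w = 2 * ωfun2 δ z5 w := by
    intro w hw
    have h1 : w - 1 ≠ 0 := ne_of_gt (by linarith)
    have h2 : w + 1 ≠ 0 := ne_of_gt (by linarith)
    have h3 : w - δ ≠ 0 := ne_of_gt (by linarith)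
    have h4 : w + δ ≠ 0 := ne_of_gt (by linarith)
    have h5 : w - z5 ≠ 0 := ne_of_gt (by linarith)
    have hs : α ^ 2 * δ ^ 2 = -(2 * α * z5) - 1 := by
      rw [hz5]; field_simp; ring
    have hden : (w ^ 2 - 1) * (-2 + 2 * w ^ 2 - γ) * (2 + 4 * w * α + α ^ 2 * (2 + γ))
        = 8 * α * ((w - 1) * (w + 1) * (w - δ) * (w + δ) * (w - z5)) := by
      have : 2 + 4 * w * α + α ^ 2 * (2 + γ) = 4 * α * (w - z5) := by
        rw [hγ']; linear_combination 2 * hs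
      rw [this, hγ']; ring
    have hnum : -8 * w ^ 2 * α + 16 * w ^ 4 * α - 4 * α * (2 + γ)
        + 6 * w ^ 3 * (2 + α ^ 2 * (2 + γ)) - w * (6 + γ) * (2 + α ^ 2 * (2 + γ))
        = 8 * α * (2 * w ^ 4 - w ^ 2 - δ ^ 2 - 3 * z5 * w ^ 3 + z5 * w * (2 + δ ^ 2)) := by
      have : 2 + α ^ 2 * (2 + γ) = -(4 * α * z5) := by
        rw [hγ']; linear_combination 2 * hs
      rw [this, hγ']; ring
    unfold pcoef2 ωfun2
    rw [hden, hnum]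
    field_simp
    ring
  have hd : deriv (pcoef2 α γ) (δ + 1) = 2 * deriv (ωfun2 δ z5) (δ + 1) := by
    have he : pcoef2 α γ =ᶠ[nhds (δ + 1)] fun w => 2 * ωfun2 δ z5 w := by
      filter_upwards [lt_mem_nhds (show δ < δ + 1 by linarith)] with w hw
      exact key w hw
    rw [he.deriv_eq, deriv_const_mul_field]
  have hq : 0 < qcoef2 α γ (δ + 1) := by
    unfold qcoef2
    have h1 : 0 < (δ + 1) ^ 2 - 1 := by nlinarith
    have h2 : 0 < -2 + 2 * (δ + 1) ^ 2 - γ := by rw [hγ']; nlinarith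
    have h3 : 0 < δ + 1 := by linarith
    positivity
  refine ⟨δ + 1, ⟨ne_of_gt (by linarith), ne_of_gt (by linarith), ne_of_gt (by linarith),
    ne_of_gt (by linarith), ne_of_gt (by linarith)⟩, ?_⟩
  have heq : deriv (ωfun2 δ z5) (δ + 1) + (ωfun2 δ z5 (δ + 1)) ^ 2 - rred2 α γ (δ + 1)
      = qcoef2 α γ (δ + 1) := by
    unfold rred2
    rw [hd, key (δ + 1) (by linarith)]
    ring
  rw [heq]
  exact hq.ne'
end

section
/- Let 0 < α < 1 and set γ = 2(1 − α²)/α², so that δ := sqrt(1 + γ/2) = 1/α > 1. Let p(z) = [−8z²α + 16z⁴α − 4α(2 + γ) + 6z³(2 + α²(2 + γ)) − z(6 + γ)(2 + α²(2 + γ))]/[(z²−1)(−2 + 2z² − γ)(2 + 4zα + α²(2 + γ))] and q(z) = 2(1 + zα)(4α + z(2 + α²(2 + γ)))/[(z²−1)α(−2 + 2z² − γ)(2 + 4zα + α²(2 + γ))]. Then for every z at which both sides are defined, −q(z) + p'(z)/2 + p(z)²/4 = −3/(16(z−1)²) − 3/(16(z+1)²) − 1/(4(z−1/α)²) − (1 +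 3α)/(16(α−1)(z−1)) + (−1 + 3α)/(16(α+1)(z+1)) + α³/(2(α²−1)(z−1/α)) − α/(2(z+1/α)). -/
/-- In the confluent case `δ = 1/α` (i.e. `γ = 2(1-α²)/α²`), the reduced coefficient
`r = -q + p'/2 + p²/4` has the indicated partial-fraction expansion. -/
theorem stmt_14 (α : ℝ) (hα0 : 0 < α) (hα1 : α < 1) (γ : ℝ)
    (hγ : γ = 2 * (1 - α ^ 2) / α ^ 2)
    (hδ : Real.sqrt (1 + γ / 2) = 1 / α) :
    ∀ z : ℝ, z ≠ 1 → z ≠ -1 → z ≠ 1 / α → z ≠ -(1 / α) →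
      -qcoef2 α γ z + deriv (pcoef2 α γ) z / 2 + (pcoef2 α γ z) ^ 2 / 4
        = -3 / (16 * (z - 1) ^ 2) - 3 / (16 * (z + 1) ^ 2) - 1 / (4 * (z - 1 / α) ^ 2)
          - (1 + 3 * α) / (16 * (α - 1) * (z - 1))
          + (-1 + 3 * α) / (16 * (α + 1) * (z + 1))
          + α ^ 3 / (2 * (α ^ 2 - 1) * (z - 1 / α))
          - α / (2 * (z + 1 / α)) := by
  intro z h1 h2 h3 h4
  have hα : α ≠ 0 := hα0.ne'
  have key : ∀ y : ℝ, y ≠ 1 → y ≠ -1 → y ≠ 1 / α → y ≠ -(1 / α) →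
      (y - 1 ≠ 0 ∧ y + 1 ≠ 0 ∧ y * α - 1 ≠ 0 ∧ y * α + 1 ≠ 0) := by
    intro y a b c d
    refine ⟨sub_ne_zero.2 a, fun h => b (by linarith), fun h => c ?_, fun h => d ?_⟩
    · field_simp; linarith
    · field_simp; linarith
  have hg : 2 + γ = 2 / α ^ 2 := by rw [hγ]; field_simp; ring
  have hg4 : 2 + α ^ 2 * (2 + γ) = 4 := by rw [hg]; field_simp; norm_num
  have hden : ∀ y : ℝ, (-2 + 2 * y ^ 2 - γ) = 2 * (y * α - 1) * (y * α + 1) / α ^ 2 := by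
    intro y
    have : γ = 2 / α ^ 2 - 2 := by linarith
    rw [this]; field_simp; ring
  have hlin : ∀ y : ℝ, 2 + 4 * y * α + α ^ 2 * (2 + γ) = 4 * (y * α + 1) := by
    intro y; linarith
  have hp : ∀ y : ℝ, y ≠ 1 → y ≠ -1 → y ≠ 1 / α → y ≠ -(1 / α) →
      pcoef2 α γ y = 1 / 2 * (y - 1)⁻¹ + 1 / 2 * (y + 1)⁻¹ + α * (y * α - 1)⁻¹ := by
    intro y a b c d
    obtain ⟨a, b, c, d⟩ := key y a b c d
    have e : y ^ 2 - 1 = (y - 1) * (y + 1) := by ring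
    have g6 : 6 + γ = 4 + 2 / α ^ 2 := by linarith
    unfold pcoef2
    rw [hlin, hden, hg4, hg, g6, e]
    field_simp
    ring
  have hd : deriv (pcoef2 α γ) z = -(1 / 2) / (z - 1) ^ 2 - (1 / 2) / (z + 1) ^ 2
      - α ^ 2 / (z * α - 1) ^ 2 := by
    have hev : pcoef2 α γ =ᶠ[nhds z]
        fun y => 1 / 2 * (y - 1)⁻¹ + 1 / 2 * (y + 1)⁻¹ + α * (y * α - 1)⁻¹ := by
      filter_upwards [isOpen_ne.mem_nhds h1, isOpen_ne.mem_nhds h2, isOpen_ne.mem_nhds h3,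
        isOpen_ne.mem_nhds h4] with y a b c d
      exact hp y a b c d
    rw [hev.deriv_eq]
    obtain ⟨a, b, c, d⟩ := key z h1 h2 h3 h4
    have H := (((((hasDerivAt_id' z).sub_const 1).fun_inv a).const_mul (1 / 2)).fun_add
      ((((hasDerivAt_id' z).add_const 1).fun_inv b).const_mul (1 / 2))).fun_add
      (((((hasDerivAt_id' z).mul_const α).sub_const 1).fun_inv c).const_mul α)
    rw [H.deriv]
    ring
  rw [hd, hp z h1 h2 h3 h4]
  obtain ⟨a, b, c, d⟩ := key z h1 h2 h3 h4
  have hq : qcoef2 α γ z = α * (α + z) / ((z - 1) * (z + 1) * (z * α - 1) * (z * α + 1)) := by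
    have e : z ^ 2 - 1 = (z - 1) * (z + 1) := by ring
    unfold qcoef2
    rw [hlin, hden, hg4, e]
    have d' : 1 + z * α ≠ 0 := by rwa [add_comm]
    field_simp
    ring
  rw [hq]
  have e1 : z - 1 / α = (z * α - 1) / α := by field_simp
  have e2 : z + 1 / α = (z * α + 1) / α := by field_simp
  have e3 : α ^ 2 - 1 = (α - 1) * (α + 1) := by ring
  have f1 : α - 1 ≠ 0 := by linarith
  have f2 : α + 1 ≠ 0 := by linarith
  have c2 : α * z - 1 ≠ 0 := by rwa [mul_comm α z]
  have d2 : α * z + 1 ≠ 0 := by rwa [mul_comm α z]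
  rw [e1, e2, e3]
  field_simp
  ring
end

section
/- Let 0 < α < 1 and set γ = 2(1 − α²)/α² (so δ := sqrt(1 + γ/2) = 1/α). Let r(z) = −3/(16(z−1)²) − 3/(16(z+1)²) − 1/(4(z−1/α)²) − (1 + 3α)/(16(α−1)(z−1)) + (−1 + 3α)/(16(α+1)(z+1)) + α³/(2(α²−1)(z−1/α)) − α/(2(z+1/α)), and define ω(z) = 1/(4(z−1)) + 1/(4(z+1)) + 1/(2(z−1/α)). Then the rational function ω'(z) + ω(z)² − r(z) is not identically zero; equivalently, P = 1 does not solve P'' + 2ωP' + (ω' + ω² − r)P = 0, so the equation w'' = r(z)w admits no exponential solution exp(∫ω) with this ω. -/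
/-- The reduced coefficient `r(z)` in the confluent case `δ = 1/α`. -/
noncomputable def rconf (α : ℝ) (z : ℝ) : ℝ :=
  -3 / (16 * (z - 1) ^ 2) - 3 / (16 * (z + 1) ^ 2) - 1 / (4 * (z - 1 / α) ^ 2)
    - (1 + 3 * α) / (16 * (α - 1) * (z - 1))
    + (-1 + 3 * α) / (16 * (α + 1) * (z + 1))
    + α ^ 3 / (2 * (α ^ 2 - 1) * (z - 1 / α))
    - α / (2 * (z + 1 / α))

/-- The Kovacic candidate `ω` for the exponent tuple `(1/4, 1/4, 1/2, 0, 1)`. -/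
noncomputable def ωconf (α : ℝ) (z : ℝ) : ℝ :=
  1 / (4 * (z - 1)) + 1 / (4 * (z + 1)) + 1 / (2 * (z - 1 / α))

/-- The rational function `ω' + ω² - r` is not identically zero: `P = 1` does not solve
`P'' + 2ωP' + (ω' + ω² - r)P = 0`, so `w'' = r w` has no exponential solution `exp ∫ ω`. -/
theorem stmt_15 (α : ℝ) (hα0 : 0 < α) (hα1 : α < 1) (γ : ℝ)
    (hγ : γ = 2 * (1 - α ^ 2) / α ^ 2) :
    ∃ z : ℝ, (z ≠ 1 ∧ z ≠ -1 ∧ z ≠ 1 / α ∧ z ≠ -(1 / α)) ∧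
      deriv (ωconf α) z + (ωconf α z) ^ 2 - rconf α z ≠ 0 := by
  have ha : α ≠ 0 := hα0.ne'
  have h1 : α - 1 ≠ 0 := by linarith
  have h2 : α + 1 ≠ 0 := by linarith
  have hp : (0 : ℝ) < 1 / α := by positivity
  have hd : HasDerivAt (ωconf α) (-1 / 2 - α ^ 2 / 2) 0 := by
    have e1 : HasDerivAt (fun z : ℝ => 4 * (z - 1)) (4 * 1) 0 :=
      ((hasDerivAt_id (0 : ℝ)).sub_const 1).const_mul 4
    have e2 : HasDerivAt (fun z : ℝ => 4 * (z + 1)) (4 * 1) 0 :=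
      ((hasDerivAt_id (0 : ℝ)).add_const 1).const_mul 4
    have e3 : HasDerivAt (fun z : ℝ => 2 * (z - 1 / α)) (2 * 1) 0 :=
      ((hasDerivAt_id (0 : ℝ)).sub_const (1 / α)).const_mul 2
    have k1 := (hasDerivAt_const (0 : ℝ) (1 : ℝ)).fun_div e1 (by norm_num)
    have k2 := (hasDerivAt_const (0 : ℝ) (1 : ℝ)).fun_div e2 (by norm_num)
    have k3 := (hasDerivAt_const (0 : ℝ) (1 : ℝ)).fun_div e3 (by simpa using ha)
    refine ((k1.fun_add k2).fun_add k3).congr_deriv ?_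
    field_simp
    ring
  refine ⟨0, ⟨by norm_num, by norm_num, hp.ne, by linarith⟩, ?_⟩
  have key : deriv (ωconf α) 0 + (ωconf α 0) ^ 2 - rconf α 0 = α ^ 2 := by
    have h3 : α ^ 2 - 1 = (α - 1) * (α + 1) := by ring
    rw [hd.deriv]
    unfold ωconf rconf
    rw [h3]
    simp only [zero_sub, zero_add]
    field_simp
    ring
  rw [key]
  positivity
end

section
/- Let α be a real number with α > 0 and α ≠ 1, set z3 = −(1 + α²)/(2α), and let r(z) = −7/(16(z−z3)²) − α²/(2(α+1)²(z−1)) + α²/(2(α−1)²(z+1)) − 2α³/((α²−1)²(z−z3)). For each choice of sign, define ω(z) = (1/2 ± i·sqrt(3)/4)/(z−z3) (a complex rational function). Then for both sign choices the rational function ω'(z) + ω(z)² − r(z) is not identically zero; in fact ω' + ω² − r = α²/(2(α+1)²(z−1)) − α²/(2(α−1)²(z+1)) + 2α³/((α²−1)²(z−z3)), which is nonzero since α ≠ 0. Consequently, the equation w'' = r(z)w admits no exponential solution exp(∫ω) with either candidate ω. -/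
/-- The reduced coefficient `r(z)` with `z3 = -(1+α²)/(2α)`. -/
noncomputable def rZ (α z3 : ℝ) (z : ℂ) : ℂ :=
  -7 / (16 * (z - (z3 : ℂ)) ^ 2)
    - (α : ℂ) ^ 2 / (2 * ((α : ℂ) + 1) ^ 2 * (z - 1))
    + (α : ℂ) ^ 2 / (2 * ((α : ℂ) - 1) ^ 2 * (z + 1))
    - 2 * (α : ℂ) ^ 3 / (((α : ℂ) ^ 2 - 1) ^ 2 * (z - (z3 : ℂ)))

/-- The Kovacic candidate `ω(z) = (1/2 ± i√3/4)/(z - z3)`. -/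
noncomputable def ωZ (ε z3 : ℝ) (z : ℂ) : ℂ :=
  ((1 / 2 : ℂ) + (ε : ℂ) * Complex.I * (Real.sqrt 3 : ℂ) / 4) / (z - (z3 : ℂ))

/-- For both sign choices, `ω' + ω² - r` equals the indicated nonzero rational function, so
`w'' = r w` admits no exponential solution `exp ∫ ω` with either candidate `ω`. -/
theorem stmt_19 (α : ℝ) (hα0 : 0 < α) (hα1 : α ≠ 1) (z3 : ℝ)
    (hz3 : z3 = -(1 + α ^ 2) / (2 * α)) :
    ∀ ε : ℝ, (ε = 1 ∨ ε = -1) →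
      (∀ z : ℂ, z ≠ 1 → z ≠ -1 → z ≠ (z3 : ℂ) →
        deriv (ωZ ε z3) z + (ωZ ε z3 z) ^ 2 - rZ α z3 z
          = (α : ℂ) ^ 2 / (2 * ((α : ℂ) + 1) ^ 2 * (z - 1))
            - (α : ℂ) ^ 2 / (2 * ((α : ℂ) - 1) ^ 2 * (z + 1))
            + 2 * (α : ℂ) ^ 3 / (((α : ℂ) ^ 2 - 1) ^ 2 * (z - (z3 : ℂ)))) ∧
      (∃ z : ℂ, (z ≠ 1 ∧ z ≠ -1 ∧ z ≠ (z3 : ℂ)) ∧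
        deriv (ωZ ε z3) z + (ωZ ε z3 z) ^ 2 - rZ α z3 z ≠ 0) := by
  intro ε hε
  have key : ∀ z : ℂ, z ≠ 1 → z ≠ -1 → z ≠ (z3 : ℂ) →
        deriv (ωZ ε z3) z + (ωZ ε z3 z) ^ 2 - rZ α z3 z
          = (α : ℂ) ^ 2 / (2 * ((α : ℂ) + 1) ^ 2 * (z - 1))
            - (α : ℂ) ^ 2 / (2 * ((α : ℂ) - 1) ^ 2 * (z + 1))
            + 2 * (α : ℂ) ^ 3 / (((α : ℂ) ^ 2 - 1) ^ 2 * (z - (z3 : ℂ))) := by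
    intro z h1 h2 h3
    have hz : z - (z3 : ℂ) ≠ 0 := sub_ne_zero.mpr h3
    have hs : ((Real.sqrt 3 : ℝ) : ℂ) ^ 2 = 3 := by
      rw [← Complex.ofReal_pow, Real.sq_sqrt (by norm_num)]; norm_num
    have hε2 : (ε : ℂ) ^ 2 = 1 := by
      rcases hε with h | h <;> simp [h]
    obtain ⟨c, hc⟩ : ∃ c : ℂ, c = (1 / 2 : ℂ) + (ε : ℂ) * Complex.I * (Real.sqrt 3 : ℂ) / 4 :=
      ⟨_, rfl⟩
    have hcc : c ^ 2 - c = -7 / 16 := by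
      have : c ^ 2 - c = (ε : ℂ) ^ 2 * Complex.I ^ 2 * ((Real.sqrt 3 : ℝ) : ℂ) ^ 2 / 16 - 1 / 4 := by
        rw [hc]; ring
      rw [this, hs, hε2, Complex.I_sq]; norm_num
    have hω : ωZ ε z3 = fun z => c / (z - (z3 : ℂ)) := by
      funext z; simp only [ωZ, hc]
    have hd : HasDerivAt (ωZ ε z3) (-c / (z - (z3 : ℂ)) ^ 2) z := by
      rw [hω]
      have := (hasDerivAt_const z c).div ((hasDerivAt_id z).sub_const (z3 : ℂ)) hz
      refine HasDerivAt.congr_deriv (f := fun z : ℂ => c / (z - (z3 : ℂ))) this ?_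
      simp
    rw [hd.deriv, hω]
    have e : -c / (z - (z3 : ℂ)) ^ 2 + (c / (z - (z3 : ℂ))) ^ 2
        = -7 / (16 * (z - (z3 : ℂ)) ^ 2) := by
      have : -c / (z - (z3 : ℂ)) ^ 2 + (c / (z - (z3 : ℂ))) ^ 2
        = (c ^ 2 - c) / (z - (z3 : ℂ)) ^ 2 := by
        rw [div_pow, ← add_div]; congr 1; ring
      rw [this, hcc, div_div]
    simp only [rZ]
    rw [e]; ring
  refine ⟨key, 0, ?_⟩
  have hz0 : z3 ≠ 0 := by
    rw [hz3]
    exact div_ne_zero (by nlinarith [sq_nonneg α]) (by positivity)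
  have h3 : (0 : ℂ) ≠ (z3 : ℂ) := by exact_mod_cast hz0.symm
  refine ⟨⟨by norm_num, by norm_num, h3⟩, ?_⟩
  rw [key 0 (by norm_num) (by norm_num) h3]
  have ha : α + 1 ≠ 0 := by positivity
  have hb : α - 1 ≠ 0 := sub_ne_zero.mpr hα1
  have hr : α ^ 2 / (2 * (α + 1) ^ 2 * (0 - 1)) - α ^ 2 / (2 * (α - 1) ^ 2 * (0 + 1))
      + 2 * α ^ 3 / ((α ^ 2 - 1) ^ 2 * (0 - z3)) = - α ^ 2 / (1 + α ^ 2) := by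
    have hq : 1 + α ^ 2 ≠ 0 := by positivity
    have h0 : α ≠ 0 := hα0.ne'
    have hf : α ^ 2 - 1 = (α + 1) * (α - 1) := by ring
    have hi : 0 - z3 = (1 + α ^ 2) / (2 * α) := by rw [hz3]; ring
    rw [hi, hf]
    field_simp
    ring
  have hne : - α ^ 2 / (1 + α ^ 2) ≠ 0 := by
    have : 0 < α ^ 2 / (1 + α ^ 2) := by positivity
    rw [neg_div]; exact (neg_lt_zero.mpr this).ne
  rw [← hr] at hne
  exact_mod_cast hne
end
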